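/- arXiv:1902.01519 — 2 statements merged into one kernel-verified Lean document; each statement's English description precedes it below -/
import Mathlib

section
/- (Variable-exponent Strömberg–Wheeden lemma.) Let $0<\alpha<n$ and $p(\cdot)\in\mathcal{P}_0$ with $p(\cdot)\in LH$ and $0<p_-\le p_+<n/\alpha$, and define $q(\cdot)$ by $1/p(\cdot)-1/q(\cdot)=\alpha/n$. Then there is a constant $C$ such that for every countable collection of cubes $\{Q_k\}$ and positive numbers $\{\lambda_k\}$, $$\Big\|\sum_k\lambda_k|Q_k|^{\alpha/n}\chi_{Q_k}\Big\|_{L^{q(\cdot)}}\le C\,\Big\|\sum_k\lambda_k\chi_{Q_k}\Big\|_{L^{p(\cdot)}}.$$ -/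
open MeasureTheory ENNReal Filter Topology

noncomputable section

/-- Euclidean space `ℝⁿ`. -/
abbrev Rn (n : ℕ) := EuclideanSpace ℝ (Fin n)

variable {n : ℕ}

/-- The closed axis-parallel cube with center `c` and half side length `r`. -/
def stdCube (c : Rn n) (r : ℝ) : Set (Rn n) := {y | ∀ i, |y i - c i| ≤ r}

/-- A cube with sides parallel to the coordinate axes. -/
def IsCube (Q : Set (Rn n)) : Prop := ∃ (c : Rn n) (r : ℝ), 0 < r ∧ Q = stdCube c r

/-- The average `⨍_Q f` of `f` over `Q`. -/
def cubeAvg (Q : Set (Rn n)) (f : Rn n → ℝ) : ℝ := (volume Q).toReal⁻¹ * ∫ y in Q, f y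

/-- The average `⨍_Q f` of a nonnegative function over `Q`, computed in `ℝ≥0∞`. -/
def cubeAvgE (Q : Set (Rn n)) (f : Rn n → ℝ) : ℝ≥0∞ :=
  (∫⁻ y in Q, ENNReal.ofReal (f y)) / volume Q

/-- The `L^q` average `(⨍_Q f^q)^{1/q}` of a nonnegative function over `Q`, in `ℝ≥0∞`. -/
def cubeAvgEq (Q : Set (Rn n)) (f : Rn n → ℝ) (q : ℝ) : ℝ≥0∞ :=
  ((∫⁻ y in Q, ENNReal.ofReal (f y) ^ q) / volume Q) ^ (1/q)

/-- A weight: a nonnegative locally integrable function, positive a.e. -/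
def IsWeight (w : Rn n → ℝ) : Prop :=
  LocallyIntegrable w volume ∧ (∀ x, 0 ≤ w x) ∧ ∀ᵐ x ∂(volume : Measure (Rn n)), 0 < w x

/-- The Muckenhoupt `A_1` condition with constant `C`. -/
def MuckA1With (w : Rn n → ℝ) (C : ℝ) : Prop :=
  ∀ Q : Set (Rn n), IsCube Q → ∀ᵐ x ∂(volume : Measure (Rn n)), x ∈ Q → cubeAvg Q w ≤ C * w x

/-- The Muckenhoupt `A_r` condition (`1 < r`) with constant `C`. -/
def MuckArWith (w : Rn n → ℝ) (r C : ℝ) : Prop :=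
  ∀ Q : Set (Rn n), IsCube Q →
    cubeAvg Q w * (cubeAvg Q fun x => w x ^ (1 - r / (r - 1))) ^ (r - 1) ≤ C

/-- The Muckenhoupt `A_r` condition, `r ≥ 1`. -/
def MuckA (w : Rn n → ℝ) (r : ℝ) : Prop :=
  (r = 1 ∧ ∃ C : ℝ, 0 < C ∧ MuckA1With w C) ∨
  (1 < r ∧ ∃ C : ℝ, 0 < C ∧ MuckArWith w r C)

/-- The class `A_∞ = ⋃_{r ≥ 1} A_r`. -/
def AInfty (w : Rn n → ℝ) : Prop := ∃ r : ℝ, 1 ≤ r ∧ MuckA w r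

/-- `r_w = inf { r ≥ 1 : w ∈ A_r }`. -/
def rIdx (w : Rn n → ℝ) : ℝ := sInf {r : ℝ | 1 ≤ r ∧ MuckA w r}

/-- The reverse Hölder condition `RH_s` with constant `C`. -/
def RHWith (w : Rn n → ℝ) (s C : ℝ) : Prop :=
  ∀ Q : Set (Rn n), IsCube Q → (cubeAvg Q fun x => w x ^ s) ^ (1/s) ≤ C * cubeAvg Q w

/-- The reverse Hölder class `RH_s`, `1 < s < ∞`. -/
def RH (w : Rn n → ℝ) (s : ℝ) : Prop := ∃ C : ℝ, 0 < C ∧ RHWith w s C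

/-- The reverse Hölder class `RH_∞`. -/
def RHInfty (w : Rn n → ℝ) : Prop :=
  ∃ C : ℝ, 0 < C ∧ ∀ Q : Set (Rn n), IsCube Q →
    ∀ᵐ x ∂(volume : Measure (Rn n)), x ∈ Q → w x ≤ C * cubeAvg Q w

/-- The weighted Lebesgue quasi-norm `‖f‖_{L^p(w)}`. -/
def weightedLp (p : ℝ) (w : Rn n → ℝ) (f : Rn n → ℝ) : ℝ≥0∞ :=
  (∫⁻ x, ENNReal.ofReal |f x| ^ p * ENNReal.ofReal (w x)) ^ (1/p)

/-- The weighted Lebesgue quasi-norm, for `ℝ≥0∞`-valued functions. -/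
def weightedLpE (p : ℝ) (w : Rn n → ℝ) (F : Rn n → ℝ≥0∞) : ℝ≥0∞ :=
  (∫⁻ x, F x ^ p * ENNReal.ofReal (w x)) ^ (1/p)

/-- The variable Lebesgue quasi-norm `‖F‖_{L^{p(·)}}`, for `ℝ≥0∞`-valued functions. -/
def varLpE (p : Rn n → ℝ) (F : Rn n → ℝ≥0∞) : ℝ≥0∞ :=
  sInf {lam : ℝ≥0∞ | 0 < lam ∧ ∫⁻ x, (F x / lam) ^ (p x) ≤ 1}

/-- The variable Lebesgue quasi-norm `‖f‖_{L^{p(·)}}`. -/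
def varLp (p : Rn n → ℝ) (f : Rn n → ℝ) : ℝ≥0∞ :=
  varLpE p fun x => ENNReal.ofReal |f x|

/-- An exponent function in `𝒫₀`: measurable with values in `(0,∞)`. -/
def ExponentP0 (p : Rn n → ℝ) : Prop := Measurable p ∧ ∀ x, 0 < p x

/-- Log-Hölder continuity, locally and at infinity. -/
def LogHolder (p : Rn n → ℝ) : Prop :=
  (∃ C₀ : ℝ, 0 < C₀ ∧ ∀ x y : Rn n, 0 < ‖x - y‖ → ‖x - y‖ < 1/2 →
      |p x - p y| ≤ C₀ / (-Real.log ‖x - y‖)) ∧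
  (∃ pinf Cinf : ℝ, 0 < Cinf ∧ ∀ x : Rn n, |p x - pinf| ≤ Cinf / Real.log (Real.exp 1 + ‖x‖))

/-- The partial derivative `∂_i f`. -/
def pderiv (i : Fin n) (f : Rn n → ℝ) : Rn n → ℝ :=
  fun x => fderiv ℝ f x (EuclideanSpace.single i 1)

/-- The higher-order partial derivative `∂^β f` for a multi-index `β`. -/
def multiDeriv (β : Fin n → ℕ) (f : Rn n → ℝ) : Rn n → ℝ :=
  (List.finRange n).foldr (fun i g => (pderiv i)^[β i] g) f

/-- An `(N,∞)` atom supported in the cube `Q`. -/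
def IsNAtom (N : ℕ) (a : Rn n → ℝ) (Q : Set (Rn n)) : Prop :=
  Measurable a ∧ (∀ x, |a x| ≤ 1) ∧ IsCube Q ∧ Function.support a ⊆ Q ∧
    ∀ β : Fin n → ℕ, (∑ i, β i) ≤ N → ∫ x, (∏ i, x i ^ β i) * a x = 0

/-- Membership in `𝒪_N`: a smooth compactly supported function with vanishing moments
up to order `N`. -/
def InON (N : ℕ) (f : Rn n → ℝ) : Prop :=
  ContDiff ℝ (⊤ : ℕ∞) f ∧ HasCompactSupport f ∧
    ∀ β : Fin n → ℕ, (∑ i, β i) ≤ N → ∫ x, (∏ i, x i ^ β i) * f x = 0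

/-- Tempered distributions on `ℝⁿ`. -/
abbrev TemperedDist (n : ℕ) := SchwartzMap (Rn n) ℝ →L[ℝ] ℝ

/-- The tempered distribution `u` is represented by the function `f`. -/
def Represents (u : TemperedDist n) (f : Rn n → ℝ) : Prop :=
  ∀ ψ : SchwartzMap (Rn n) ℝ, u ψ = ∫ x, f x * ψ x

/-- Membership in the class `𝒮_{N₀}`:
`∫ (1+|x|)^{N₀} (∑_{|β| ≤ N₀} |∂^β φ(x)|²) dx ≤ 1`. -/
def inSN (N₀ : ℕ) (φ : SchwartzMap (Rn n) ℝ) : Prop :=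
  ∫ x : Rn n, (1 + ‖x‖) ^ N₀ *
      ∑ β : Fin n → Fin (N₀ + 1),
        (if (∑ i, (β i : ℕ)) ≤ N₀ then
          (multiDeriv (fun i => (β i : ℕ)) (fun y => φ y) x) ^ 2 else 0) ≤ 1

/-- The grand maximal function `𝓜_{N₀} u (x) = sup_{φ ∈ 𝒮_{N₀}} sup_{t>0} |φ_t * u (x)|`,
where `φ_t * u (x) = u (y ↦ t^{-n} φ((x-y)/t))`. -/
def grandMax (N₀ : ℕ) (u : TemperedDist n) (x : Rn n) : ℝ≥0∞ :=
  sSup {r : ℝ≥0∞ | ∃ (φ ψ : SchwartzMap (Rn n) ℝ) (t : ℝ), 0 < t ∧ inSN N₀ φ ∧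
      (∀ y, ψ y = ((t ^ n)⁻¹ : ℝ) * φ (t⁻¹ • (x - y))) ∧ r = ENNReal.ofReal |u ψ|}

/-- The weighted Hardy space quasi-norm `‖u‖_{H^p(w)} = ‖𝓜_{N₀} u‖_{L^p(w)}`. -/
def hardyNorm (N₀ : ℕ) (p : ℝ) (w : Rn n → ℝ) (u : TemperedDist n) : ℝ≥0∞ :=
  weightedLpE p w (grandMax N₀ u)

/-- The variable Hardy space quasi-norm `‖u‖_{H^{p(·)}} = ‖𝓜_{N₀} u‖_{L^{p(·)}}`. -/
def hardyNormVar (N₀ : ℕ) (p : Rn n → ℝ) (u : TemperedDist n) : ℝ≥0∞ :=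
  varLpE p (grandMax N₀ u)

/-- The fractional maximal operator `M_γ` (the Hardy–Littlewood maximal operator if
`γ = 0`). -/
def fracMax (γ : ℝ) (f : Rn n → ℝ) (x : Rn n) : ℝ≥0∞ :=
  ⨆ (Q : Set (Rn n)) (_ : IsCube Q ∧ x ∈ Q),
    volume Q ^ (γ / (n : ℝ)) * ((∫⁻ y in Q, ENNReal.ofReal |f y|) / volume Q)

/-- `T` is bounded on (unweighted) `L²`. -/
def L2Bounded (T : (Rn n → ℝ) → Rn n → ℝ) : Prop :=
  ∃ A : ℝ, 0 < A ∧ ∀ f : Rn n → ℝ, Measurable f →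
    weightedLp 2 (fun _ => 1) (T f) ≤ ENNReal.ofReal A * weightedLp 2 (fun _ => 1) f

/-- The standard kernel size estimate `|K(x,y)| ≤ C|x-y|^{-n}`. -/
def CZKernelSize (K : Rn n → Rn n → ℝ) (C : ℝ) : Prop :=
  ∀ x y : Rn n, x ≠ y → |K x y| ≤ C * ‖x - y‖ ^ (-(n : ℝ))

/-- The standard kernel smoothness (Hölder) estimate of order `δ`. -/
def CZKernelSmooth (K : Rn n → Rn n → ℝ) (δ C : ℝ) : Prop :=
  ∀ x y h : Rn n, x ≠ y → ‖h‖ ≤ ‖x - y‖ / 2 →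
    |K x (y + h) - K x y| + |K (x + h) y - K x y| ≤ C * ‖h‖ ^ δ * ‖x - y‖ ^ (-(n : ℝ) - δ)

/-- A (non-convolution type) Calderón–Zygmund operator: bounded on `L²`, represented off
the support by a kernel `K` satisfying the standard estimates with exponent `δ`. -/
def CZOp (T : (Rn n → ℝ) → Rn n → ℝ) (K : Rn n → Rn n → ℝ) (δ : ℝ) : Prop :=
  L2Bounded T ∧ 0 < δ ∧ δ ≤ 1 ∧
  (∃ C : ℝ, 0 < C ∧ CZKernelSize K C ∧ CZKernelSmooth K δ C) ∧
  ∀ f : Rn n → ℝ, Measurable f → (∃ M : ℝ, ∀ x, |f x| ≤ M) → HasCompactSupport f →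
    ∀ x ∉ tsupport f, T f x = ∫ y, K x y * f y

/-- The higher-order smoothness condition on the kernel:
`|∂_y^β K(x,y+h) - ∂_y^β K(x,y)| ≤ C |h|^δ |x-y|^{-(n+m+δ)}` for all `|β| = m`. -/
def KernelHigherSmooth (K : Rn n → Rn n → ℝ) (δ : ℝ) (m : ℕ) (C : ℝ) : Prop :=
  (∀ x : Rn n, ContDiffOn ℝ m (fun z => K x z) {x}ᶜ) ∧
  ∀ β : Fin n → ℕ, (∑ i, β i) = m →
    ∀ x y h : Rn n, x ≠ y → ‖h‖ ≤ ‖x - y‖ / 2 →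
      |multiDeriv β (fun z => K x z) (y + h) - multiDeriv β (fun z => K x z) y|
        ≤ C * ‖h‖ ^ δ * ‖x - y‖ ^ (-((n : ℝ) + m + δ))

/-- `T` has `L` vanishing moments: `∫ x^β T a(x) dx = 0` for all `(L+1,∞)` atoms `a` and
all multi-indices `|β| ≤ L`.  (Vacuous if `L = -1`.) -/
def VanishingMoments (T : (Rn n → ℝ) → Rn n → ℝ) (L : ℤ) : Prop :=
  ∀ (a : Rn n → ℝ) (Q : Set (Rn n)), IsNAtom (L + 1).toNat a Q →
    ∀ β : Fin n → ℕ, (∑ i, (β i : ℤ)) ≤ L → ∫ x, (∏ i, x i ^ β i) * T a x = 0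

/-- Regularity of order `N+1` for a convolution kernel:
`|∂^α K(x)| ≤ A |x|^{-n-|α|}` for all `|α| ≤ N+1`. -/
def ConvKernelReg (K : Rn n → ℝ) (N : ℕ) : Prop :=
  ContDiffOn ℝ (N + 1 : ℕ) K {0}ᶜ ∧
  ∃ A : ℝ, 0 < A ∧ ∀ β : Fin n → ℕ, (∑ i, β i) ≤ N + 1 →
    ∀ x : Rn n, x ≠ 0 → |multiDeriv β K x| ≤ A * ‖x‖ ^ (-(n : ℝ) - (∑ i, β i))

/-- A Calderón–Zygmund singular integral operator of convolution type with regularity of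
order `N+1`: `T` is bounded on `L²` (equivalently, the kernel has bounded Fourier
transform), and `T f(x) = p.v. ∫ K(x-y) f(y) dy` for `f ∈ C_c^∞`. -/
def ConvCZO (T : (Rn n → ℝ) → Rn n → ℝ) (K : Rn n → ℝ) (N : ℕ) : Prop :=
  L2Bounded T ∧ ConvKernelReg K N ∧
  ∀ f : Rn n → ℝ, ContDiff ℝ (⊤ : ℕ∞) f → HasCompactSupport f → ∀ x : Rn n,
    Tendsto (fun ε : ℝ => ∫ y in {y : Rn n | ε < ‖x - y‖}, K (x - y) * f y)
      (𝓝[>] 0) (𝓝 (T f x))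

/-- The fractional integral operator `I_α`. -/
def fracInt (α : ℝ) (f : Rn n → ℝ) (x : Rn n) : ℝ :=
  ∫ y, f y * ‖x - y‖ ^ (α - (n : ℝ))

/-- The radial maximal function `M_φ g(x) = sup_{t>0} |φ_t * g(x)|` of a function `g`. -/
def MphiSup (φ : Rn n → ℝ) (g : Rn n → ℝ) (x : Rn n) : ℝ≥0∞ :=
  ⨆ (t : ℝ) (_ : 0 < t), ENNReal.ofReal |∫ y, (t ^ n)⁻¹ * φ (t⁻¹ • (x - y)) * g y|

/-! ### Geometry of cubes -/

theorem measurableSet_stdCube (c : Rn n) (r : ℝ) : MeasurableSet (stdCube c r) := by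
  have h : stdCube c r = ⋂ i, {y : Rn n | |y i - c i| ≤ r} := by
    ext y; simp [stdCube]
  rw [h]
  refine MeasurableSet.iInter fun i => IsClosed.measurableSet ?_
  exact isClosed_le (by fun_prop) continuous_const

theorem volume_stdCube (c : Rn n) {r : ℝ} (hr : 0 ≤ r) :
    volume (stdCube c r) = ENNReal.ofReal ((2 * r) ^ n) := by
  have h : stdCube c r = (MeasurableEquiv.toLp 2 (Fin n → ℝ)).symm ⁻¹'
      Set.Icc (fun i => c i - r) (fun i => c i + r) := by
    ext y
    simp only [stdCube, Set.mem_ofPred_eq, Set.mem_preimage, Set.mem_Icc, Pi.le_def, abs_le]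
    constructor
    · intro h
      exact ⟨fun i => by have := (h i).1; simp; linarith,
        fun i => by have := (h i).2; simp; linarith⟩
    · rintro ⟨h1, h2⟩ i
      have h1 := h1 i
      have h2 := h2 i
      simp at h1 h2
      constructor <;> linarith
  rw [h, (EuclideanSpace.volume_preserving_symm_measurableEquiv_toLp (Fin n)).measure_preimage
    measurableSet_Icc.nullMeasurableSet, Real.volume_Icc_pi]
  have : ∀ i : Fin n, c i + r - (c i - r) = 2 * r := fun i => by ring
  simp only [this, Finset.prod_const, Finset.card_univ, Fintype.card_fin]
  rw [ENNReal.ofReal_pow (by positivity)]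

theorem exists_interval_away_from_zero (a : ℝ) {h : ℝ} (hh : 0 < h) :
    ∃ m : ℝ, ∀ y : ℝ, |y - m| ≤ h / 8 → a ≤ y ∧ y ≤ a + h ∧ h / 4 ≤ |y| := by
  rcases le_total 0 (a + h / 2) with h0 | h0
  · refine ⟨a + 7 * h / 8, fun y hy => ?_⟩
    rw [abs_le] at hy
    exact ⟨by linarith, by linarith, le_abs.2 (Or.inl (by linarith))⟩
  · refine ⟨a + h / 8, fun y hy => ?_⟩
    rw [abs_le] at hy
    exact ⟨by linarith, by linarith, le_abs.2 (Or.inr (by linarith))⟩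

/-- Every cube of side at least `s` containing `x` contains one of `2 ^ n` cubes of side `s / 8`
which stay close to `x` and away from the coordinate hyperplanes. -/
theorem exists_corner_cubes (x : Rn n) {s : ℝ} (hs : 0 < s) :
    ∃ m : (Fin n → Bool) → Rn n,
      (∀ ε, ∀ y ∈ stdCube (m ε) (s / 16), ∀ i, |y i - x i| ≤ s / 2 ∧ s / 8 ≤ |y i|) ∧
      ∀ (c : Rn n) (r : ℝ), s ≤ 2 * r → x ∈ stdCube c r →
        ∃ ε, stdCube (m ε) (s / 16) ⊆ stdCube c r := by
  have key : ∀ (i : Fin n) (b : Bool), ∃ m : ℝ, ∀ y : ℝ, |y - m| ≤ s / 2 / 8 →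
      (if b then x i else x i - s / 2) ≤ y ∧ y ≤ (if b then x i else x i - s / 2) + s / 2 ∧
        s / 2 / 4 ≤ |y| :=
    fun i b => exists_interval_away_from_zero _ (by positivity)
  choose m0 hm0 using key
  have hdiv : s / 16 = s / 2 / 8 := by ring
  refine ⟨fun ε => WithLp.toLp 2 fun i => m0 i (ε i), fun ε y hy i => ?_, fun c r hr hx => ?_⟩
  · obtain ⟨h1, h2, h3⟩ := hm0 i (ε i) (y i) (by rw [← hdiv]; exact hy i)
    refine ⟨?_, by linarith⟩
    rw [abs_le]
    split_ifs at h1 h2 <;> constructor <;> linarith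
  · refine ⟨fun i => decide (x i + s / 2 ≤ c i + r), fun y hy i => ?_⟩
    obtain ⟨h1, h2, -⟩ := hm0 i (decide (x i + s / 2 ≤ c i + r)) (y i)
      (by rw [← hdiv]; exact hy i)
    have hxi := abs_le.1 (hx i)
    rw [abs_le]
    by_cases h : x i + s / 2 ≤ c i + r
    · simp only [h, decide_true, if_true] at h1 h2
      constructor <;> linarith
    · simp only [h, decide_false, Bool.false_eq_true, if_false] at h1 h2
      push Not at h
      constructor <;> linarith

theorem exists_stdCube_sum_le (c : ℕ → Rn n) (r : ℕ → ℝ) (w : ℕ → ℝ≥0∞) (x : Rn n) {s : ℝ}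
    (hs : 0 < s) :
    ∃ m : Rn n, ∀ y ∈ stdCube m (s / 16), (∀ i, |y i - x i| ≤ s / 2 ∧ s / 8 ≤ |y i|) ∧
      (∑' k, {k | s ≤ 2 * r k}.indicator
        (fun k => w k * (stdCube (c k) (r k)).indicator (fun _ => (1 : ℝ≥0∞)) x) k) / 2 ^ n ≤
      ∑' k, w k * (stdCube (c k) (r k)).indicator (fun _ => (1 : ℝ≥0∞)) y := by
  classical
  obtain ⟨m, hm, hc⟩ := exists_corner_cubes x hs
  set S : (Fin n → Bool) → ℝ≥0∞ := fun ε =>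
    ∑' k, if stdCube (m ε) (s / 16) ⊆ stdCube (c k) (r k) then w k else 0 with hS
  obtain ⟨ε, -, hε⟩ := Finset.exists_max_image Finset.univ S Finset.univ_nonempty
  refine ⟨m ε, fun y hy => ⟨hm ε y hy, ?_⟩⟩
  have h1 : (∑' k, {k | s ≤ 2 * r k}.indicator
        (fun k => w k * (stdCube (c k) (r k)).indicator (fun _ => (1 : ℝ≥0∞)) x) k) ≤
      ∑ ε, S ε := by
    rw [hS, ← Summable.tsum_finsetSum fun _ _ => ENNReal.summable]
    refine ENNReal.tsum_le_tsum fun k => ?_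
    by_cases hk : s ≤ 2 * r k ∧ x ∈ stdCube (c k) (r k)
    · obtain ⟨ε', hε'⟩ := hc (c k) (r k) hk.1 hk.2
      calc _ = w k := by simp [Set.indicator, hk.1, hk.2]
        _ = if stdCube (m ε') (s / 16) ⊆ stdCube (c k) (r k) then w k else 0 := by
          rw [if_pos hε']
        _ ≤ _ := Finset.single_le_sum (f := fun ε =>
          if stdCube (m ε) (s / 16) ⊆ stdCube (c k) (r k) then w k else 0)
          (fun _ _ => zero_le) (Finset.mem_univ ε')
    · have : {k | s ≤ 2 * r k}.indicator
        (fun k => w k * (stdCube (c k) (r k)).indicator (fun _ => (1 : ℝ≥0∞)) x) k = 0 := by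
        by_cases h : s ≤ 2 * r k
        · have hx : x ∉ stdCube (c k) (r k) := fun hx => hk ⟨h, hx⟩
          simp [Set.indicator, hx]
        · simp [Set.indicator, h]
      rw [this]
      exact zero_le
  have h2 : ∑ ε, S ε ≤ 2 ^ n * S ε := by
    refine (Finset.sum_le_card_nsmul _ _ _ hε).trans (le_of_eq ?_)
    simp
  have h3 : S ε ≤ ∑' k, w k * (stdCube (c k) (r k)).indicator (fun _ => (1 : ℝ≥0∞)) y := by
    refine ENNReal.tsum_le_tsum fun k => ?_
    split_ifs with h
    · simp [Set.indicator, h hy]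
    · exact zero_le
  refine ENNReal.div_le_of_le_mul' ?_
  exact h1.trans (h2.trans (by gcongr))

/-! ### Summation over scales -/

theorem tsum_indicator_mul_rpow_le {v : ℕ → ℝ≥0∞} {l : ℕ → ℝ} {a b δ t K : ℝ}
    (ha : 0 < a) (hδ : 0 < δ) (hb : a + δ ≤ b) (ht : 0 < t) (hK : 0 ≤ K)
    (h : ∀ s, t ≤ s → ∑' k, {k | s ≤ l k}.indicator v k ≤ ENNReal.ofReal (K * s ^ (-b))) :
    ∑' k, {k | t ≤ l k}.indicator (fun k => v k * ENNReal.ofReal (l k ^ a)) k ≤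
      ENNReal.ofReal (K * (2 ^ a * (1 - 2 ^ (-δ))⁻¹) * t ^ (a - b)) := by
  have hq0 : (0 : ℝ) ≤ 2 ^ (-δ) := by positivity
  have hq1 : (2 : ℝ) ^ (-δ) < 1 := Real.rpow_lt_one_of_one_lt_of_neg (by norm_num) (by linarith)
  have h1 : ∀ k, {k | t ≤ l k}.indicator (fun k => v k * ENNReal.ofReal (l k ^ a)) k ≤
      ∑' j : ℕ, ENNReal.ofReal ((2 ^ (j + 1) * t) ^ a) *
        {k | 2 ^ j * t ≤ l k}.indicator v k := by
    intro k
    by_cases hk : t ≤ l k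
    · obtain ⟨j, hj1, hj2⟩ := exists_nat_pow_near (x := l k / t) (y := 2)
        (by rwa [le_div_iff₀ ht, one_mul]) (by norm_num)
      rw [le_div_iff₀ ht] at hj1
      rw [div_lt_iff₀ ht] at hj2
      refine le_trans ?_ (ENNReal.le_tsum j)
      have e1 : k ∈ {k | t ≤ l k} := hk
      have e2 : k ∈ {k | 2 ^ j * t ≤ l k} := hj1
      rw [Set.indicator_of_mem e1, Set.indicator_of_mem e2, mul_comm]
      gcongr
      linarith
    · simp [Set.indicator, hk]
  refine (ENNReal.tsum_le_tsum h1).trans ?_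
  rw [ENNReal.tsum_comm]
  have h2 : ∀ j : ℕ, ∑' k, ENNReal.ofReal ((2 ^ (j + 1) * t) ^ a) *
        {k | 2 ^ j * t ≤ l k}.indicator v k ≤
      ENNReal.ofReal (K * 2 ^ a * t ^ (a - b) * (2 ^ (-δ)) ^ j) := by
    intro j
    rw [ENNReal.tsum_mul_left]
    have hj : t ≤ 2 ^ j * t := by
      have : (1 : ℝ) ≤ 2 ^ j := one_le_pow₀ (by norm_num)
      nlinarith
    refine (mul_le_mul_right (h _ hj) _).trans ?_
    rw [← ENNReal.ofReal_mul (by positivity)]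
    refine ENNReal.ofReal_le_ofReal ?_
    have e1 : ((2 : ℝ) ^ (j + 1) * t) ^ a = 2 ^ a * (2 ^ j * t) ^ a := by
      rw [pow_succ', mul_assoc, Real.mul_rpow (by norm_num) (by positivity)]
    have e2 : ((2 : ℝ) ^ j * t) ^ a * (2 ^ j * t) ^ (-b) = (2 ^ (a - b)) ^ j * t ^ (a - b) := by
      rw [← Real.rpow_add (by positivity), ← sub_eq_add_neg,
        Real.mul_rpow (by positivity) ht.le, ← Real.rpow_natCast, ← Real.rpow_mul (by norm_num),
        ← Real.rpow_natCast, ← Real.rpow_mul (by norm_num), mul_comm (j : ℝ)]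
    have e3 : ((2 : ℝ) ^ (a - b)) ^ j ≤ (2 ^ (-δ)) ^ j := by
      gcongr
      · norm_num
      · linarith
    calc _ = K * 2 ^ a * (((2 : ℝ) ^ j * t) ^ a * (2 ^ j * t) ^ (-b)) := by rw [e1]; ring
      _ = K * 2 ^ a * t ^ (a - b) * (2 ^ (a - b)) ^ j := by rw [e2]; ring
      _ ≤ _ := by gcongr
  refine (ENNReal.tsum_le_tsum h2).trans (le_of_eq ?_)
  rw [← ENNReal.ofReal_tsum_of_nonneg (fun j => by positivity)
    ((summable_geometric_of_lt_one hq0 hq1).mul_left _), tsum_mul_left,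
    tsum_geometric_of_lt_one hq0 hq1]
  congr 1
  ring

/-- A Hedberg-type inequality for weighted sums of powers. -/
theorem tsum_mul_rpow_le {v : ℕ → ℝ≥0∞} {l : ℕ → ℝ} {a b δ f K : ℝ}
    (ha : 0 < a) (hδ : 0 < δ) (hb : a + δ ≤ b) (hK : 0 ≤ K) (hl : ∀ k, 0 < l k)
    (hf : 0 < f) (hv : ∑' k, v k ≤ ENNReal.ofReal f)
    (h : ∀ s, f ^ (-1 / b) ≤ s →
      ∑' k, {k | s ≤ l k}.indicator v k ≤ ENNReal.ofReal (K * s ^ (-b))) :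
    ∑' k, v k * ENNReal.ofReal (l k ^ a) ≤
      ENNReal.ofReal ((1 + K * (2 ^ a * (1 - 2 ^ (-δ))⁻¹)) * f ^ (1 - a / b)) := by
  have hq1 : (2 : ℝ) ^ (-δ) < 1 := Real.rpow_lt_one_of_one_lt_of_neg (by norm_num) (by linarith)
  have hb0 : 0 < b := by linarith
  have hq2 : 0 ≤ (1 - (2 : ℝ) ^ (-δ))⁻¹ := inv_nonneg.2 (by linarith)
  set t := f ^ (-1 / b) with ht
  have ht0 : 0 < t := by positivity
  have h1 : ∀ k, v k * ENNReal.ofReal (l k ^ a) ≤ ENNReal.ofReal (t ^ a) * v k +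
      {k | t ≤ l k}.indicator (fun k => v k * ENNReal.ofReal (l k ^ a)) k := by
    intro k
    by_cases hk : t ≤ l k
    · have e1 : k ∈ {k | t ≤ l k} := hk
      rw [Set.indicator_of_mem e1]
      exact le_add_self
    · rw [mul_comm]
      refine le_add_right ?_
      have := hl k
      gcongr
      exact (not_le.1 hk).le
  refine (ENNReal.tsum_le_tsum h1).trans ?_
  rw [ENNReal.tsum_add, ENNReal.tsum_mul_left]
  refine (add_le_add (mul_le_mul_right hv _)
    (tsum_indicator_mul_rpow_le ha hδ hb ht0 hK h)).trans (le_of_eq ?_)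
  rw [← ENNReal.ofReal_mul (by positivity), ← ENNReal.ofReal_add (by positivity) (by positivity)]
  have e1 : t ^ a * f = f ^ (1 - a / b) := by
    rw [ht, ← Real.rpow_mul hf.le]
    nth_rewrite 2 [← Real.rpow_one f]
    rw [← Real.rpow_add hf]
    congr 1
    field_simp
    ring
  have e2 : t ^ (a - b) = f ^ (1 - a / b) := by
    rw [ht, ← Real.rpow_mul hf.le]
    congr 1
    field_simp
    ring
  rw [e1, e2]
  congr 1
  ring

theorem tsum_mul_rpow_le_of_one_le {v : ℕ → ℝ≥0∞} {l : ℕ → ℝ} {a b b' δ f K : ℝ}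
    (ha : 0 < a) (hδ : 0 < δ) (hb : a + δ ≤ b) (hb' : a + δ ≤ b') (hK : 0 ≤ K)
    (hl : ∀ k, 0 < l k) (hf : 1 ≤ f) (hv : ∑' k, v k ≤ ENNReal.ofReal f)
    (h : ∀ s, 0 < s → s ≤ 1 →
      ∑' k, {k | s ≤ l k}.indicator v k ≤ ENNReal.ofReal (K * s ^ (-b)))
    (h' : ∀ s, 1 ≤ s →
      ∑' k, {k | s ≤ l k}.indicator v k ≤ ENNReal.ofReal (K * s ^ (-b'))) :
    ∑' k, v k * ENNReal.ofReal (l k ^ a) ≤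
      ENNReal.ofReal ((1 + 2 * (K * (2 ^ a * (1 - 2 ^ (-δ))⁻¹))) * f ^ (1 - a / b)) := by
  have hq1 : (2 : ℝ) ^ (-δ) < 1 := Real.rpow_lt_one_of_one_lt_of_neg (by norm_num) (by linarith)
  have hb0 : 0 < b := by linarith
  have hq2 : 0 ≤ (1 - (2 : ℝ) ^ (-δ))⁻¹ := inv_nonneg.2 (by linarith)
  have hlarge := tsum_indicator_mul_rpow_le ha hδ hb' one_pos hK h'
  have hsmall := tsum_mul_rpow_le (v := {k | l k < 1}.indicator v) (f := f) ha hδ hb hK hl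
    (by linarith)
    ((ENNReal.tsum_le_tsum fun k => Set.indicator_le_self' (fun _ _ => zero_le) k).trans hv) (by
      intro s hs
      have hs0 : 0 < s := lt_of_lt_of_le (Real.rpow_pos_of_pos (by linarith) _) hs
      rcases le_total s 1 with h1 | h1
      · refine le_trans (ENNReal.tsum_le_tsum fun k => ?_) (h s hs0 h1)
        exact Set.indicator_le_indicator (Set.indicator_le_self' (fun _ _ => zero_le) k)
      · have : ∀ k, {k | s ≤ l k}.indicator ({k | l k < 1}.indicator v) k = 0 := by
          intro k
          simp only [Set.indicator, Set.mem_ofPred_eq]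
          split_ifs <;> first | rfl | linarith
        simp [this])
  have hsplit : ∀ k, v k * ENNReal.ofReal (l k ^ a) =
      {k | l k < 1}.indicator v k * ENNReal.ofReal (l k ^ a) +
      {k | 1 ≤ l k}.indicator (fun k => v k * ENNReal.ofReal (l k ^ a)) k := by
    intro k
    simp only [Set.indicator, Set.mem_ofPred_eq]
    rcases lt_or_ge (l k) 1 with h1 | h1
    · simp [h1, not_le.2 h1]
    · simp [h1, not_lt.2 h1]
  rw [tsum_congr hsplit, ENNReal.tsum_add]
  refine (add_le_add hsmall hlarge).trans ?_
  rw [← ENNReal.ofReal_add (by positivity) (by positivity)]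
  refine ENNReal.ofReal_le_ofReal ?_
  have hf1 : 1 ≤ f ^ (1 - a / b) := by
    refine Real.one_le_rpow hf ?_
    rw [sub_nonneg, div_le_one hb0]
    linarith
  rw [Real.one_rpow, mul_one]
  have hC : 0 ≤ K * (2 ^ a * (1 - 2 ^ (-δ))⁻¹) := by positivity
  nlinarith

/-! ### Log-Hölder continuous exponents -/

theorem norm_sub_le_of_forall_abs_le {x y : Rn n} {s : ℝ} (hs : 0 ≤ s)
    (h : ∀ i, |y i - x i| ≤ s / 2) : ‖x - y‖ ≤ n * s := by
  rw [EuclideanSpace.norm_eq]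
  refine Real.sqrt_le_iff.2 ⟨by positivity, ?_⟩
  have h1 : ∀ i ∈ Finset.univ, ‖(x - y) i‖ ^ 2 ≤ s ^ 2 := by
    intro i _
    have : ‖(x - y) i‖ = |y i - x i| := by
      rw [PiLp.sub_apply, Real.norm_eq_abs, abs_sub_comm]
    rw [this]
    have := h i
    gcongr
    linarith
  refine (Finset.sum_le_card_nsmul _ _ _ h1).trans ?_
  simp only [Finset.card_univ, Fintype.card_fin, nsmul_eq_mul]
  rw [mul_pow]
  have : (n : ℝ) ≤ (n : ℝ) ^ 2 := by exact_mod_cast Nat.le_self_pow (by norm_num) n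
  gcongr

theorem exists_abs_sub_mul_abs_log_le {p : Rn n → ℝ} {B C₀ : ℝ} (hn : 0 < n) (hB : 0 ≤ B)
    (hpB : ∀ x y, |p x - p y| ≤ B) (hC : 0 < C₀)
    (h : ∀ x y : Rn n, 0 < ‖x - y‖ → ‖x - y‖ < 1 / 2 →
      |p x - p y| ≤ C₀ / (-Real.log ‖x - y‖)) :
    ∃ D : ℝ, 0 ≤ D ∧ ∀ (x y : Rn n) (s : ℝ), 0 < s → s ≤ 1 → (∀ i, |y i - x i| ≤ s / 2) →
      |p y - p x| * |Real.log s| ≤ D := by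
  have hn1 : (1 : ℝ) ≤ n := by exact_mod_cast hn
  have hlog0 : 0 ≤ Real.log (4 * (n : ℝ) ^ 2) := Real.log_nonneg (by nlinarith)
  refine ⟨2 * C₀ + B * Real.log (4 * (n : ℝ) ^ 2), by positivity, fun x y s hs hs1 hxy => ?_⟩
  rw [abs_of_nonpos (Real.log_nonpos hs.le hs1)]
  by_cases hsmall : 4 * (n : ℝ) ^ 2 * s < 1
  · rcases eq_or_ne x y with rfl | hne
    · simp only [sub_self, abs_zero, zero_mul]
      positivity
    have hpos : 0 < ‖x - y‖ := norm_pos_iff.2 (sub_ne_zero.2 hne)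
    have hle := norm_sub_le_of_forall_abs_le hs.le hxy
    have hsq : ‖x - y‖ ^ 2 ≤ s / 4 := by
      calc ‖x - y‖ ^ 2 ≤ (n * s) ^ 2 := by gcongr
        _ = (4 * (n : ℝ) ^ 2 * s) * (s / 4) := by ring
        _ ≤ 1 * (s / 4) := by gcongr
        _ = s / 4 := one_mul _
    have hhalf : ‖x - y‖ < 1 / 2 := by
      have : s < 1 := by nlinarith
      nlinarith
    have hlog : 2 * Real.log ‖x - y‖ ≤ Real.log s := by
      have := Real.log_le_log (by positivity) (hsq.trans (by linarith : s / 4 ≤ s))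
      rwa [Real.log_pow, Nat.cast_ofNat] at this
    have hneg : 0 < -Real.log ‖x - y‖ := by
      have := Real.log_neg hpos (by linarith)
      linarith
    have h1 := h x y hpos hhalf
    rw [le_div_iff₀ hneg, abs_sub_comm] at h1
    have h2 : |p y - p x| * (-Real.log s) ≤ |p y - p x| * (2 * -Real.log ‖x - y‖) := by
      gcongr
      linarith
    have : 0 ≤ B * Real.log (4 * (n : ℝ) ^ 2) := by positivity
    linarith
  · have h1 : -Real.log s ≤ Real.log (4 * (n : ℝ) ^ 2) := by
      rw [← Real.log_inv]
      refine Real.log_le_log (by positivity) ?_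
      rw [inv_le_iff_one_le_mul₀ hs]
      linarith
    have h2 : |p y - p x| * (-Real.log s) ≤ B * Real.log (4 * (n : ℝ) ^ 2) := by
      have := Real.log_nonpos hs.le hs1
      exact mul_le_mul (hpB y x) h1 (by linarith) hB
    linarith

theorem abs_sub_mul_abs_log_le_of_le_norm {p : Rn n → ℝ} {P C s : ℝ}
    (h : ∀ x : Rn n, |p x - P| ≤ C / Real.log (Real.exp 1 + ‖x‖)) (hs : 1 ≤ s) {y : Rn n}
    (hy : s / 8 ≤ ‖y‖) : |p y - P| * |Real.log s| ≤ C * (Real.log 8 + 1) := by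
  have he : 1 < Real.exp 1 := Real.one_lt_exp_iff.2 one_pos
  have hL : 1 ≤ Real.log (Real.exp 1 + ‖y‖) := by
    rw [Real.le_log_iff_exp_le (by positivity)]
    linarith [norm_nonneg y]
  have h1 := h y
  rw [le_div_iff₀ (by linarith)] at h1
  rw [abs_of_nonneg (Real.log_nonneg hs)]
  have h2 : Real.log s ≤ Real.log 8 + Real.log (Real.exp 1 + ‖y‖) := by
    rw [← Real.log_mul (by norm_num) (by positivity)]
    exact Real.log_le_log (by linarith) (by linarith)
  have h8 : 0 ≤ Real.log 8 := Real.log_nonneg (by norm_num)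
  calc |p y - P| * Real.log s
      ≤ |p y - P| * ((Real.log 8 + 1) * Real.log (Real.exp 1 + ‖y‖)) := by
        gcongr
        nlinarith
    _ = |p y - P| * Real.log (Real.exp 1 + ‖y‖) * (Real.log 8 + 1) := by ring
    _ ≤ C * (Real.log 8 + 1) := by gcongr

theorem continuous_of_logHolder {p : Rn n → ℝ} {C₀ : ℝ} (hC : 0 < C₀)
    (h : ∀ x y : Rn n, 0 < ‖x - y‖ → ‖x - y‖ < 1 / 2 →
      |p x - p y| ≤ C₀ / (-Real.log ‖x - y‖)) : Continuous p := by
  rw [Metric.continuous_iff]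
  intro y ε hε
  refine ⟨min (1 / 2) (Real.exp (-(C₀ / ε))), by positivity, fun x hx => ?_⟩
  rcases eq_or_ne x y with rfl | hne
  · simpa using hε
  have hpos : 0 < ‖x - y‖ := norm_pos_iff.2 (sub_ne_zero.2 hne)
  rw [dist_eq_norm, lt_min_iff] at hx
  rw [Real.dist_eq]
  refine (h x y hpos hx.1).trans_lt ?_
  have h1 : Real.log ‖x - y‖ < -(C₀ / ε) := (Real.log_lt_iff_lt_exp hpos).2 hx.2
  have h2 : 0 < C₀ / ε := by positivity
  rw [div_lt_comm₀ (by linarith) hε]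
  linarith

theorem exists_abs_sub_lt_of_decay {p : Rn n → ℝ} {P C : ℝ} (hn : 0 < n)
    (h : ∀ x : Rn n, |p x - P| ≤ C / Real.log (Real.exp 1 + ‖x‖)) {ε : ℝ} (hε : 0 < ε) :
    ∃ x, |p x - P| < ε := by
  have : Nonempty (Fin n) := ⟨⟨0, hn⟩⟩
  obtain ⟨x, hx⟩ := NormedSpace.exists_lt_norm ℝ (Rn n) (Real.exp (C / ε + 1))
  refine ⟨x, (h x).trans_lt ?_⟩
  have h1 : max 1 (C / ε + 1) ≤ Real.log (Real.exp 1 + ‖x‖) := by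
    rw [Real.le_log_iff_exp_le (by positivity)]
    rcases max_cases 1 (C / ε + 1) with ⟨e, -⟩ | ⟨e, -⟩ <;> rw [e]
    · linarith [norm_nonneg x]
    · linarith [Real.exp_pos 1]
  have h2 := (le_max_left _ _).trans h1
  have h3 := (le_max_right _ _).trans h1
  rw [div_lt_iff₀ (by linarith), mul_comm, ← div_lt_iff₀ hε]
  linarith

theorem forall_mem_Icc_of_ae {p : Rn n → ℝ} (hp : Continuous p) {a b : ℝ}
    (h : ∀ᵐ x ∂(volume : Measure (Rn n)), p x ∈ Set.Icc a b) (x : Rn n) :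
    p x ∈ Set.Icc a b := by
  have h1 : IsClosed {x | p x ∈ Set.Icc a b} := isClosed_Icc.preimage hp
  have h2 := Measure.dense_of_ae h
  have h3 : {x | p x ∈ Set.Icc a b} = Set.univ := by
    rw [← h1.closure_eq, h2.closure_eq]
  have : x ∈ {x | p x ∈ Set.Icc a b} := h3 ▸ Set.mem_univ x
  exact this

theorem mem_Icc_of_decay {p : Rn n → ℝ} {P C a b : ℝ} (hn : 0 < n)
    (h : ∀ x : Rn n, |p x - P| ≤ C / Real.log (Real.exp 1 + ‖x‖))
    (hp : ∀ x, p x ∈ Set.Icc a b) : P ∈ Set.Icc a b := by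
  constructor
  · by_contra! hlt
    obtain ⟨x, hx⟩ := exists_abs_sub_lt_of_decay hn h (sub_pos.2 hlt)
    linarith [(hp x).1, (abs_lt.1 hx).2]
  · by_contra! hlt
    obtain ⟨x, hx⟩ := exists_abs_sub_lt_of_decay hn h (sub_pos.2 hlt)
    linarith [(hp x).2, (abs_lt.1 hx).1]

/-! ### Modular estimates -/

/-- A lower bound for `F` on a cube of side `s / 8` is controlled by `s ^ (-n / P)`, if `P` is
close to the exponent on that cube. -/
theorem le_ofReal_of_lintegral_rpow_le_one {p : Rn n → ℝ} {F : Rn n → ℝ≥0∞} {pm P D s : ℝ}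
    {m : Rn n} {c : ℝ≥0∞} (hn : 0 < n) (hs : 0 < s) (hpm : 0 < pm) (hp : ∀ x, pm ≤ p x)
    (hP : pm ≤ P) (hD0 : 0 ≤ D) (hD : ∀ y ∈ stdCube m (s / 16), |p y - P| * |Real.log s| ≤ D)
    (hc : ∀ y ∈ stdCube m (s / 16), c ≤ F y) (hF : ∫⁻ x, F x ^ p x ≤ 1) :
    c ≤ ENNReal.ofReal ((16 ^ n * Real.exp (n * D / pm)) ^ (1 / pm) * s ^ (-(n / P))) := by
  by_contra! hlt
  have hP0 : 0 < P := by linarith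
  have hbase : (1 : ℝ) ≤ 16 ^ n * Real.exp (n * D / pm) := by
    have h1 : (1 : ℝ) ≤ 16 ^ n := one_le_pow₀ (by norm_num)
    have h2 : 1 ≤ Real.exp (n * D / pm) := Real.one_le_exp (by positivity)
    nlinarith
  set K : ℝ := (16 ^ n * Real.exp (n * D / pm)) ^ (1 / pm) with hK
  have hK1 : 1 ≤ K := Real.one_le_rpow hbase (by positivity)
  have hpt : ∀ y ∈ stdCube m (s / 16), ENNReal.ofReal (16 ^ n * (s ^ n)⁻¹) ≤ F y ^ p y := by
    intro y hy
    have hpy := hp y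
    have hpy0 : 0 < p y := by linarith
    refine le_trans ?_ (ENNReal.rpow_le_rpow (hlt.le.trans (hc y hy)) hpy0.le)
    rw [ENNReal.ofReal_rpow_of_pos (by positivity)]
    refine ENNReal.ofReal_le_ofReal ?_
    rw [Real.mul_rpow (by positivity) (by positivity)]
    have e1 : 16 ^ n * Real.exp (n * D / pm) ≤ K ^ p y := by
      calc 16 ^ n * Real.exp (n * D / pm) = K ^ pm := by
            rw [hK, ← Real.rpow_mul (by positivity), one_div_mul_cancel hpm.ne', Real.rpow_one]
        _ ≤ K ^ p y := Real.rpow_le_rpow_of_exponent_le hK1 hpy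
    have e2 : Real.exp (-(n * D / pm)) * (s ^ n)⁻¹ ≤ (s ^ (-(n / P))) ^ p y := by
      have e3 : (s ^ n)⁻¹ = Real.exp (-(n * Real.log s)) := by
        rw [Real.exp_neg, mul_comm, Real.exp_mul, Real.exp_log hs, Real.rpow_natCast]
      rw [← Real.rpow_mul hs.le, Real.rpow_def_of_pos hs, e3, ← Real.exp_add]
      refine Real.exp_le_exp.2 ?_
      have e4 : Real.log s * (-(n / P) * p y) =
          -(n * Real.log s) - n / P * ((p y - P) * Real.log s) := by
        field_simp
        ring
      rw [e4]
      have e5 : (p y - P) * Real.log s ≤ D :=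
        (le_abs_self _).trans (by rw [abs_mul]; exact hD y hy)
      have e6 : n / P * ((p y - P) * Real.log s) ≤ n * D / pm := by
        calc n / P * ((p y - P) * Real.log s) ≤ n / P * D := by gcongr
          _ ≤ n / pm * D := by gcongr
          _ = n * D / pm := by ring
      linarith
    calc (16 : ℝ) ^ n * (s ^ n)⁻¹
        = (16 ^ n * Real.exp (n * D / pm)) * (Real.exp (-(n * D / pm)) * (s ^ n)⁻¹) := by
          rw [Real.exp_neg]
          field_simp
      _ ≤ _ := by gcongr
  have h1 : ENNReal.ofReal (16 ^ n * (s ^ n)⁻¹) * volume (stdCube m (s / 16)) ≤ 1 := by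
    rw [← setLIntegral_const]
    exact (setLIntegral_mono' (measurableSet_stdCube _ _) hpt).trans
      ((setLIntegral_le_lintegral _ _).trans hF)
  rw [volume_stdCube _ (by positivity), ← ENNReal.ofReal_mul (by positivity),
    ENNReal.ofReal_le_one] at h1
  have h2 : (16 : ℝ) ^ n * (s ^ n)⁻¹ * (2 * (s / 16)) ^ n = 2 ^ n := by
    rw [← inv_pow, ← mul_pow, ← mul_pow]
    congr 1
    field_simp
  rw [h2] at h1
  have : (1 : ℝ) < 2 ^ n := one_lt_pow₀ (by norm_num) hn.ne'
  linarith

theorem rpow_le_exp_mul_rpow_add {f L p r D M r0 : ℝ} (hf : 0 < f) (hf1 : f ≤ 1) (hL : 1 < L)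
    (hd : |r - p| * Real.log L ≤ D) (hr0 : 0 < r0) (hr : r0 ≤ r) (hM : 0 ≤ M) :
    f ^ r ≤ Real.exp (M / r0 * D) * f ^ p + L ^ (-M) := by
  have hL0 : 0 < L := by linarith
  rcases le_total (L ^ (-(M / r0))) f with h | h
  · refine le_add_of_le_of_nonneg ?_ (by positivity)
    have e1 : f ^ r = f ^ (r - p) * f ^ p := by rw [← Real.rpow_add hf]; ring_nf
    rw [e1]
    gcongr
    calc f ^ (r - p) ≤ f ^ (-|r - p|) :=
          Real.rpow_le_rpow_of_exponent_ge hf hf1 (neg_abs_le _)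
      _ ≤ (L ^ (-(M / r0))) ^ (-|r - p|) :=
          Real.rpow_le_rpow_of_nonpos (by positivity) h (by simp)
      _ = Real.exp (M / r0 * (|r - p| * Real.log L)) := by
          rw [← Real.rpow_mul hL0.le, Real.rpow_def_of_pos hL0]
          ring_nf
      _ ≤ _ := by gcongr
  · refine le_add_of_nonneg_of_le (by positivity) ?_
    calc f ^ r ≤ f ^ r0 := Real.rpow_le_rpow_of_exponent_ge hf hf1 hr
      _ ≤ (L ^ (-(M / r0))) ^ r0 := by gcongr
      _ = L ^ (-M) := by
          rw [← Real.rpow_mul hL0.le]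
          congr 1
          field_simp

/-- At a point `x`, the total weight of the cubes of side at least `s` containing `x`. -/
theorem tsum_indicator_le_of_lintegral_rpow_le_one {p : Rn n → ℝ} {pm P D s : ℝ} {x : Rn n}
    {c : ℕ → Rn n} {r : ℕ → ℝ} {w : ℕ → ℝ≥0∞} (hn : 0 < n) (hs : 0 < s) (hpm : 0 < pm)
    (hp : ∀ x, pm ≤ p x) (hP : pm ≤ P) (hD0 : 0 ≤ D)
    (hD : ∀ y : Rn n, (∀ i, |y i - x i| ≤ s / 2 ∧ s / 8 ≤ |y i|) →
      |p y - P| * |Real.log s| ≤ D)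
    (hF : ∫⁻ x, (∑' k, w k * (stdCube (c k) (r k)).indicator (fun _ => (1 : ℝ≥0∞)) x) ^ p x
      ≤ 1) :
    ∑' k, {k | s ≤ 2 * r k}.indicator
        (fun k => w k * (stdCube (c k) (r k)).indicator (fun _ => (1 : ℝ≥0∞)) x) k ≤
      ENNReal.ofReal (2 ^ n * (16 ^ n * Real.exp (n * D / pm)) ^ (1 / pm) * s ^ (-(n / P))) := by
  obtain ⟨m, hm⟩ := exists_stdCube_sum_le c r w x hs
  have h := le_ofReal_of_lintegral_rpow_le_one hn hs hpm hp hP hD0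
    (fun y hy => hD y (hm y hy).1) (fun y hy => (hm y hy).2) hF
  rw [ENNReal.div_le_iff_le_mul (Or.inl (by positivity)) (Or.inl (by simp)), mul_comm] at h
  refine h.trans (le_of_eq ?_)
  rw [mul_assoc, ENNReal.ofReal_mul (p := 2 ^ n) (by positivity), ENNReal.ofReal_pow (by norm_num),
    ENNReal.ofReal_ofNat]

theorem exists_lintegral_rpow_le_one {α pm pM P C₀ C₁ : ℝ} {p q : Rn n → ℝ} (hn : 0 < n)
    (hα : 0 < α) (hpm : 0 < pm) (hpM : α * pM < n) (hp : ∀ x, p x ∈ Set.Icc pm pM)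
    (hq : ∀ x, 1 / p x - 1 / q x = α / n) (hC₀ : 0 < C₀)
    (hloc : ∀ x y : Rn n, 0 < ‖x - y‖ → ‖x - y‖ < 1 / 2 →
      |p x - p y| ≤ C₀ / (-Real.log ‖x - y‖)) (hC₁ : 0 < C₁)
    (hinf : ∀ x : Rn n, |p x - P| ≤ C₁ / Real.log (Real.exp 1 + ‖x‖)) :
    ∃ C : ℝ, 0 < C ∧ ∀ (c : ℕ → Rn n) (r : ℕ → ℝ) (w : ℕ → ℝ≥0∞), (∀ k, 0 < r k) →
      ∫⁻ x, (∑' k, w k * (stdCube (c k) (r k)).indicator (fun _ => (1 : ℝ≥0∞)) x) ^ p x ≤ 1 →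
      ∫⁻ x, ((∑' k, w k * (stdCube (c k) (r k)).indicator (fun _ => (1 : ℝ≥0∞)) x *
        ENNReal.ofReal ((2 * r k) ^ α)) / ENNReal.ofReal C) ^ q x ≤ 1 := by
  have hn0 : (0 : ℝ) < n := by exact_mod_cast hn
  have hP : P ∈ Set.Icc pm pM := mem_Icc_of_decay hn hinf hp
  have hpM0 : 0 < pM := hpm.trans_le (hP.1.trans hP.2)
  have hpB : ∀ x y, |p x - p y| ≤ pM := fun x y => by
    rw [abs_le]
    constructor <;> linarith [(hp x).1, (hp x).2, (hp y).1, (hp y).2]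
  obtain ⟨D₀, hD₀, hDloc⟩ := exists_abs_sub_mul_abs_log_le hn hpM0.le hpB hC₀ hloc
  have hlog8 : 0 ≤ Real.log 8 := Real.log_nonneg (by norm_num)
  set D := D₀ + C₁ * (Real.log 8 + 1) with hDdef
  have hD1 : 0 ≤ C₁ * (Real.log 8 + 1) := by positivity
  have hD0 : 0 ≤ D := by positivity
  set K : ℝ := 2 ^ n * (16 ^ n * Real.exp (n * D / pm)) ^ (1 / pm) with hK
  have hK0 : 0 ≤ K := by positivity
  set δ : ℝ := n / pM - α with hδdef
  have hδ : 0 < δ := by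
    rw [hδdef, sub_pos, lt_div_iff₀ hpM0]
    exact hpM
  have hb : ∀ t ∈ Set.Icc pm pM, α + δ ≤ n / t := by
    intro t ht
    have : 0 < t := hpm.trans_le ht.1
    rw [hδdef, add_sub_cancel]
    gcongr
    exact ht.2
  have hq1 : (2 : ℝ) ^ (-δ) < 1 := Real.rpow_lt_one_of_one_lt_of_neg (by norm_num) (by linarith)
  have hq2 : 0 < (1 - (2 : ℝ) ^ (-δ))⁻¹ := inv_pos.2 (by linarith)
  set L : ℝ := K * (2 ^ α * (1 - 2 ^ (-δ))⁻¹) with hL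
  have hL0 : 0 ≤ L := by positivity
  set K₁ : ℝ := 1 + 2 * L with hK₁
  have hK₁1 : 1 ≤ K₁ := by linarith
  -- the exponents
  set θ : ℝ → ℝ := fun t => 1 - α / (n / t) with hθ
  have hθ' : ∀ t, θ t = 1 - α * t / n := fun t => by rw [hθ]; simp only [div_div_eq_mul_div]
  set θ₀ : ℝ := 1 - α * pM / n with hθ₀
  have hθ₀0 : 0 < θ₀ := by rw [hθ₀, sub_pos, div_lt_one hn0]; exact hpM
  have hθle : ∀ t ∈ Set.Icc pm pM, θ₀ ≤ θ t ∧ θ t ≤ 1 := by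
    intro t ht
    have : 0 < t := hpm.trans_le ht.1
    rw [hθ', hθ₀]
    constructor
    · gcongr
      exact ht.2
    · have : 0 < α * t / n := by positivity
      linarith
  have hqx : ∀ x, q x = p x / θ (p x) := by
    intro x
    have hpx : 0 < p x := hpm.trans_le (hp x).1
    have hθx : 0 < θ (p x) := hθ₀0.trans_le (hθle _ (hp x)).1
    have h1 : 1 / q x = θ (p x) / p x := by
      have := hq x
      rw [hθ', sub_div, mul_div_right_comm, mul_div_assoc, div_self hpx.ne', mul_one]
      linarith
    rw [← one_div_one_div (q x), h1, one_div_div]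
  have hqlb : ∀ x, pm ≤ q x := by
    intro x
    have hθx := hθle _ (hp x)
    rw [hqx, le_div_iff₀ (hθ₀0.trans_le hθx.1)]
    nlinarith [(hp x).1]
  have hqub : ∀ x, q x ≤ pM / θ₀ := by
    intro x
    rw [hqx]
    have := hθle _ (hp x)
    gcongr
    · exact (hp x).2
    · exact this.1
  set qM := pM / θ₀ with hqM
  set D₂ : ℝ := pM * α / (n * θ₀) * C₁ with hD₂
  set r₀ : ℝ := θ₀ * pm with hr₀
  have hr₀0 : 0 < r₀ := by positivity
  set A : ℝ := Real.exp (((n : ℝ) + 1) / r₀ * D₂) with hA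
  have hA1 : 1 ≤ A := Real.one_le_exp (by positivity)
  set H : Rn n → ℝ≥0∞ := fun x => ENNReal.ofReal ((1 + ‖x‖) ^ (-((n : ℝ) + 1))) with hH
  have hHint : ∫⁻ x, H x < ∞ := by
    refine finite_integral_one_add_norm ?_
    simp
  have hHmeas : Measurable H := by
    rw [hH]
    fun_prop
  set M : ℝ := K₁ ^ qM * (A + (∫⁻ x, H x).toReal) with hM
  have hM1 : 1 ≤ M := by
    have h1 : 1 ≤ K₁ ^ qM := Real.one_le_rpow hK₁1 (by positivity)
    have h2 : 1 ≤ A + (∫⁻ x, H x).toReal := by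
      have := ENNReal.toReal_nonneg (a := ∫⁻ x, H x)
      linarith
    nlinarith
  refine ⟨M ^ (1 / pm), by positivity, fun c r w hr hF => ?_⟩
  set F : Rn n → ℝ≥0∞ := fun x =>
    ∑' k, w k * (stdCube (c k) (r k)).indicator (fun _ => (1 : ℝ≥0∞)) x with hFdef
  set G : Rn n → ℝ≥0∞ := fun x => ∑' k, w k * (stdCube (c k) (r k)).indicator
    (fun _ => (1 : ℝ≥0∞)) x * ENNReal.ofReal ((2 * r k) ^ α) with hGdef
  have htail : ∀ x, ∀ s, 0 < s → s ≤ 1 → ∑' k, {k | s ≤ 2 * r k}.indicator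
      (fun k => w k * (stdCube (c k) (r k)).indicator (fun _ => (1 : ℝ≥0∞)) x) k ≤
      ENNReal.ofReal (K * s ^ (-(n / p x))) := by
    intro x s hs hs1
    refine tsum_indicator_le_of_lintegral_rpow_le_one hn hs hpm (fun y => (hp y).1) (hp x).1
      hD0 (fun y hy => ?_) hF
    exact (hDloc x y s hs hs1 fun i => (hy i).1).trans (by linarith)
  have htail' : ∀ x, ∀ s, 1 ≤ s → ∑' k, {k | s ≤ 2 * r k}.indicator
      (fun k => w k * (stdCube (c k) (r k)).indicator (fun _ => (1 : ℝ≥0∞)) x) k ≤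
      ENNReal.ofReal (K * s ^ (-(n / P))) := by
    intro x s hs1
    refine tsum_indicator_le_of_lintegral_rpow_le_one hn (by linarith) hpm (fun y => (hp y).1)
      hP.1 hD0 (fun y hy => ?_) hF
    refine (abs_sub_mul_abs_log_le_of_le_norm hinf hs1 ?_).trans
      (by linarith : C₁ * (Real.log 8 + 1) ≤ D)
    exact (hy ⟨0, hn⟩).2.trans (PiLp.norm_apply_le y ⟨0, hn⟩)
  have hl : ∀ k, 0 < 2 * r k := fun k => by linarith [hr k]
  have hpt : ∀ x, G x ^ q x ≤
      ENNReal.ofReal (K₁ ^ qM) * (ENNReal.ofReal A * F x ^ p x + H x) := by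
    intro x
    have hpx : 0 < p x := hpm.trans_le (hp x).1
    have hqx0 : 0 < q x := hpm.trans_le (hqlb x)
    have hθx : 0 < θ (p x) := hθ₀0.trans_le (hθle _ (hp x)).1
    have hKq : K₁ ^ q x ≤ K₁ ^ qM := Real.rpow_le_rpow_of_exponent_le hK₁1 (hqub x)
    have hKqM : 0 < K₁ ^ qM := by positivity
    by_cases hFtop : F x = ∞
    · rw [hFtop, ENNReal.top_rpow_of_pos hpx, ENNReal.mul_top (by positivity), top_add,
        ENNReal.mul_top (by positivity)]
      exact le_top
    by_cases hF0 : F x = 0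
    · have : G x = 0 := by
        rw [hFdef] at hF0
        simp only [ENNReal.tsum_eq_zero] at hF0
        rw [hGdef]
        simp only [hF0, zero_mul, tsum_zero]
      rw [this, ENNReal.zero_rpow_of_pos hqx0]
      exact zero_le
    obtain ⟨f, hf, hfF⟩ : ∃ f : ℝ, 0 < f ∧ F x = ENNReal.ofReal f :=
      ⟨(F x).toReal, ENNReal.toReal_pos hF0 hFtop, (ENNReal.ofReal_toReal hFtop).symm⟩
    rw [hfF, ENNReal.ofReal_rpow_of_pos hf, ← ENNReal.ofReal_mul (by positivity), hH,
      ← ENNReal.ofReal_add (by positivity) (by positivity), ← ENNReal.ofReal_mul hKqM.le]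
    rcases le_total 1 f with hf1 | hf1
    · have hG := tsum_mul_rpow_le_of_one_le hα hδ (hb _ (hp x)) (hb _ hP) hK0 hl hf1 hfF.le
        (htail x) (htail' x)
      refine (ENNReal.rpow_le_rpow hG hqx0.le).trans ?_
      rw [ENNReal.ofReal_rpow_of_pos (by positivity)]
      refine ENNReal.ofReal_le_ofReal ?_
      have e1 : (f ^ (1 - α / (n / p x))) ^ q x = f ^ p x := by
        change (f ^ θ (p x)) ^ q x = f ^ p x
        rw [← Real.rpow_mul hf.le, hqx]
        congr 1
        field_simp
      rw [Real.mul_rpow (by positivity) (by positivity), e1]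
      have e2 : f ^ p x ≤ A * f ^ p x + (1 + ‖x‖) ^ (-((n : ℝ) + 1)) := by
        have h1 : f ^ p x ≤ A * f ^ p x := le_mul_of_one_le_left (by positivity) hA1
        have h2 : 0 < (1 + ‖x‖) ^ (-((n : ℝ) + 1)) := by positivity
        linarith
      gcongr
    · have hb0 : 0 < n / P := div_pos hn0 (hpm.trans_le hP.1)
      have hG := tsum_mul_rpow_le hα hδ (hb _ hP) hK0 hl hf hfF.le (fun s hs =>
        htail' x s (le_trans (Real.one_le_rpow_of_pos_of_le_one_of_nonpos hf hf1
          (by rw [neg_div]; simp only [Left.neg_nonpos_iff]; positivity)) hs))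
      refine (ENNReal.rpow_le_rpow hG hqx0.le).trans ?_
      have hfac : 1 + K * (2 ^ α * (1 - 2 ^ (-δ))⁻¹) ≤ K₁ := by
        rw [← hL]; linarith
      rw [ENNReal.ofReal_rpow_of_pos (by positivity)]
      refine ENNReal.ofReal_le_ofReal ?_
      have hθP := hθle _ hP
      have hθP0 : 0 < θ P := hθ₀0.trans_le hθP.1
      have e1 : (f ^ (1 - α / (n / P))) ^ q x = f ^ (θ P * q x) := by
        rw [← Real.rpow_mul hf.le]
      rw [Real.mul_rpow (by positivity) (by positivity), e1]
      have hL1 : 1 < Real.exp 1 + ‖x‖ := by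
        linarith [norm_nonneg x, Real.one_lt_exp_iff.2 one_pos]
      have hlogL : 0 < Real.log (Real.exp 1 + ‖x‖) := Real.log_pos hL1
      have hdiff : |θ P * q x - p x| * Real.log (Real.exp 1 + ‖x‖) ≤ D₂ := by
        have h1 : θ P * q x - p x = p x * α / (n * θ (p x)) * (p x - P) := by
          have h2 : θ P - θ (p x) = α / n * (p x - P) := by
            rw [hθ', hθ']
            ring
          calc θ P * q x - p x = p x / θ (p x) * (θ P - θ (p x)) := by
                rw [hqx]
                field_simp
            _ = _ := by
                rw [h2]
                field_simp
        have h3 := hinf x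
        rw [le_div_iff₀ hlogL] at h3
        rw [h1, abs_mul, abs_of_nonneg (by positivity), mul_assoc, hD₂]
        have h4 := (hp x).2
        have h5 := (hθle _ (hp x)).1
        gcongr
      have e2 := rpow_le_exp_mul_rpow_add (M := (n : ℝ) + 1) hf hf1 hL1 hdiff hr₀0
        (mul_le_mul hθP.1 (hqlb x) hpm.le hθP0.le) (by positivity)
      have e3 : (Real.exp 1 + ‖x‖) ^ (-((n : ℝ) + 1)) ≤ (1 + ‖x‖) ^ (-((n : ℝ) + 1)) := by
        refine Real.rpow_le_rpow_of_nonpos (by positivity) ?_ (by linarith)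
        linarith [Real.one_lt_exp_iff.2 one_pos]
      calc (1 + K * (2 ^ α * (1 - 2 ^ (-δ))⁻¹)) ^ q x * f ^ (θ P * q x)
          ≤ K₁ ^ q x * f ^ (θ P * q x) := by gcongr
        _ ≤ K₁ ^ qM * (A * f ^ p x + (1 + ‖x‖) ^ (-((n : ℝ) + 1))) := by
          gcongr
          exact e2.trans (by gcongr)
  have hGint : ∫⁻ x, G x ^ q x ≤ ENNReal.ofReal M := by
    refine (lintegral_mono hpt).trans ?_
    rw [lintegral_const_mul' _ _ ENNReal.ofReal_ne_top, lintegral_add_right _ hHmeas,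
      lintegral_const_mul' _ _ ENNReal.ofReal_ne_top, hM,
      ENNReal.ofReal_mul (by positivity), ENNReal.ofReal_add (by positivity) (by positivity),
      ENNReal.ofReal_toReal hHint.ne]
    gcongr
    exact mul_le_of_le_one_right' hF
  have hMpos : 0 < M := by linarith
  calc ∫⁻ x, (G x / ENNReal.ofReal (M ^ (1 / pm))) ^ q x
      ≤ ∫⁻ x, (ENNReal.ofReal M)⁻¹ * G x ^ q x := by
        refine lintegral_mono fun x => ?_
        have hqx0 : 0 < q x := hpm.trans_le (hqlb x)
        change (G x / ENNReal.ofReal (M ^ (1 / pm))) ^ q x ≤ (ENNReal.ofReal M)⁻¹ * G x ^ q x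
        rw [ENNReal.div_rpow_of_nonneg _ _ hqx0.le, div_eq_mul_inv, mul_comm,
          ENNReal.ofReal_rpow_of_pos (by positivity)]
        gcongr
        rw [← Real.rpow_mul hMpos.le]
        nth_rewrite 1 [← Real.rpow_one M]
        refine Real.rpow_le_rpow_of_exponent_le hM1 ?_
        rw [one_div, inv_mul_eq_div, one_le_div hpm]
        exact hqlb x
    _ = (ENNReal.ofReal M)⁻¹ * ∫⁻ x, G x ^ q x :=
        lintegral_const_mul' _ _ (ENNReal.inv_ne_top.2 (by simpa using hMpos))
    _ ≤ (ENNReal.ofReal M)⁻¹ * ENNReal.ofReal M := by gcongr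
    _ ≤ 1 := ENNReal.inv_mul_le_one _

/-- (Variable-exponent Strömberg–Wheeden lemma.)  Let `0 < α < n` and
`p(·) ∈ 𝒫₀` with `p(·) ∈ LH` and `0 < p_- ≤ p_+ < n/α`, and define `q(·)` by
`1/p(·) - 1/q(·) = α/n`.  Then for all cubes `{Q_k}` and positive numbers `{λ_k}`,
`‖∑ λ_k |Q_k|^{α/n} χ_{Q_k}‖_{L^{q(·)}} ≲ ‖∑ λ_k χ_{Q_k}‖_{L^{p(·)}}`. -/
theorem stmt15_variable_stromberg_wheeden (n : ℕ) (α : ℝ)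
    (hα : 0 < α) (hαn : α < n) (pv qv : Rn n → ℝ)
    (hpv : ExponentP0 pv) (hLH : LogHolder pv)
    (hpm : 0 < essInf pv (volume : Measure (Rn n)))
    (hpb : ∃ B : ℝ, ∀ᵐ x ∂(volume : Measure (Rn n)), pv x ≤ B)
    (hpp : essSup pv (volume : Measure (Rn n)) < (n : ℝ) / α)
    (hqv : ∀ x, 1 / pv x - 1 / qv x = α / n) :
    ∃ C : ℝ, 0 < C ∧ ∀ (Q : ℕ → Set (Rn n)) (lam : ℕ → ℝ),
      (∀ k, IsCube (Q k)) → (∀ k, 0 < lam k) →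
      varLpE qv
          (fun x => ∑' k, ENNReal.ofReal (lam k) * volume (Q k) ^ (α / (n : ℝ)) *
            (Q k).indicator (fun _ => (1 : ℝ≥0∞)) x) ≤
        ENNReal.ofReal C * varLpE pv
          (fun x => ∑' k, ENNReal.ofReal (lam k) *
            (Q k).indicator (fun _ => (1 : ℝ≥0∞)) x) := by
  have hn0 : (0 : ℝ) < n := hα.trans hαn
  have hn : 0 < n := by exact_mod_cast hn0
  obtain ⟨⟨C₀, hC₀, hloc⟩, ⟨P, C₁, hC₁, hinf⟩⟩ := hLH
  have hae : ∀ᵐ x ∂(volume : Measure (Rn n)), pv x ∈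
      Set.Icc (essInf pv volume) (essSup pv volume) := by
    have h1 : IsBoundedUnder (· ≥ ·) (ae (volume : Measure (Rn n))) pv :=
      isBoundedUnder_of ⟨0, fun x => (hpv.2 x).le⟩
    obtain ⟨B, hB⟩ := hpb
    have h2 : IsBoundedUnder (· ≤ ·) (ae (volume : Measure (Rn n))) pv := ⟨B, hB⟩
    filter_upwards [ae_essInf_le h1, _root_.ae_le_essSup h2] with x hx1 hx2
    exact ⟨hx1, hx2⟩
  have hp := forall_mem_Icc_of_ae (continuous_of_logHolder hC₀ hloc) hae
  have hpM : α * essSup pv volume < n := by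
    rw [lt_div_iff₀ hα] at hpp
    linarith
  obtain ⟨C, hC, hmain⟩ :=
    exists_lintegral_rpow_le_one hn hα hpm hpM hp hqv hC₀ hloc hC₁ hinf
  refine ⟨C, hC, fun Q lam hQ _ => ?_⟩
  choose c r hr hQr using hQ
  have hvol : ∀ k, volume (Q k) ^ (α / (n : ℝ)) = ENNReal.ofReal ((2 * r k) ^ α) := by
    intro k
    have := hr k
    rw [hQr, volume_stdCube _ this.le, ENNReal.ofReal_rpow_of_pos (by positivity),
      ← Real.rpow_natCast, ← Real.rpow_mul (by positivity), mul_div_cancel₀ _ hn0.ne']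
  simp only [hvol]
  have hCne : ENNReal.ofReal C ≠ 0 := by simpa using hC
  rw [mul_comm, ← ENNReal.div_le_iff_le_mul (Or.inl hCne) (Or.inl ENNReal.ofReal_ne_top)]
  refine le_sInf fun t ht => ?_
  obtain ⟨ht0, ht1⟩ := ht
  rw [ENNReal.div_le_iff_le_mul (Or.inl hCne) (Or.inl ENNReal.ofReal_ne_top)]
  rcases eq_or_ne t ∞ with rfl | htop
  · rw [ENNReal.top_mul hCne]
    exact le_top
  refine sInf_le ⟨ENNReal.mul_pos ht0.ne' hCne, ?_⟩
  have h1 := hmain c r (fun k => ENNReal.ofReal (lam k) / t) hr (by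
    refine le_trans (le_of_eq (lintegral_congr fun x => ?_)) ht1
    rw [div_eq_mul_inv, ← ENNReal.tsum_mul_right]
    congr 1
    refine tsum_congr fun k => ?_
    rw [hQr, div_eq_mul_inv]
    ring)
  refine le_trans (le_of_eq (lintegral_congr fun x => ?_)) h1
  congr 1
  rw [div_eq_mul_inv, div_eq_mul_inv, ENNReal.mul_inv (Or.inl ht0.ne') (Or.inl htop), ← mul_assoc,
    ← ENNReal.tsum_mul_right]
  congr 1
  refine tsum_congr fun k => ?_
  rw [hQr, div_eq_mul_inv]
  ring
end
end

section
/- (Mollified kernel estimates.) Fix an integer $N\ge 0$ and $0\le\alpha<n$. Let $K$ be a tempered distribution on $\mathbb{R}^n$ such that $|\widehat{K}(\xi)|\le C|\xi|^{-\alpha}$, and such that away from the origin $K$ agrees with a $C^{N+1}$ function satisfying $|\partial^\beta K(x)|\le B_0|x|^{-(n-\alpha+|\beta|)}$ for all multi-indices $|\beta|\le N+1$ and $x\ne 0$. Let $\phi\in C_c^\infty$ with $\operatorname{supp}\phi\subset B(0,1)$ and $\int\phi\,dx=1$, and for $t>0$ set $\phi_t(x)=t^{-n}\phi(x/t)$ and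 $K^t=\phi_t*K$. Then $K^t$ is a smooth function and there is a constant $B_1$, independent of $t$, such that $|\partial^\beta K^t(x)|\le B_1|x|^{-(n-\alpha+|\beta|)}$ for all $|\beta|\le N+1$ and all $x\ne 0$. -/
open MeasureTheory ENNReal Filter Topology

noncomputable section

variable {n : ℕ}

/-- An iterated partial derivative is given by a list of directions. -/
lemma exists_list_multiDeriv (β : Fin n → ℕ) :
    ∃ l : List (Fin n), l.length = ∑ i, β i ∧ ∀ f, multiDeriv β f = l.foldr pderiv f := by
  have key : ∀ L : List (Fin n), ∃ l : List (Fin n), l.length = (L.map β).sum ∧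
      ∀ f : Rn n → ℝ, L.foldr (fun i g => (pderiv i)^[β i] g) f = l.foldr pderiv f := by
    intro L
    induction L with
    | nil => exact ⟨[], rfl, fun _ => rfl⟩
    | cons i L ih =>
      obtain ⟨l, hl, h⟩ := ih
      refine ⟨List.replicate (β i) i ++ l, by simp [hl], fun f => ?_⟩
      rw [List.foldr_cons, h, List.foldr_append]
      generalize l.foldr pderiv f = g
      induction β i with
      | zero => rfl
      | succ k ih => rw [Function.iterate_succ_apply', ih, List.replicate_succ, List.foldr_cons]
  obtain ⟨l, hl, h⟩ := key (List.finRange n)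
  exact ⟨l, by rw [hl, Fin.sum_univ_def], h⟩

lemma foldr_pderiv_congr (l : List (Fin n)) {f g : Rn n → ℝ} {x : Rn n} (h : f =ᶠ[𝓝 x] g) :
    l.foldr pderiv f =ᶠ[𝓝 x] l.foldr pderiv g := by
  induction l with
  | nil => exact h
  | cons i l ih =>
    filter_upwards [ih.fderiv (𝕜 := ℝ)] with y hy
    simp only [List.foldr_cons, pderiv, hy]

lemma contDiff_foldr_pderiv (l : List (Fin n)) {f : Rn n → ℝ} {k : ℕ}
    (hf : ContDiff ℝ (l.length + k : ℕ) f) : ContDiff ℝ k (l.foldr pderiv f) := by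
  induction l generalizing k with
  | nil => simpa using hf
  | cons i l ih =>
    have h : ContDiff ℝ (k + 1 : ℕ) (l.foldr pderiv f) := by
      refine ih ?_
      rwa [List.length_cons, add_assoc, add_comm 1 k] at hf
    exact (h.fderiv_right (m := k) (by norm_cast)).clm_apply contDiff_const

lemma hasCompactSupport_foldr_pderiv (l : List (Fin n)) {f : Rn n → ℝ}
    (hf : HasCompactSupport f) : HasCompactSupport (l.foldr pderiv f) := by
  induction l with
  | nil => exact hf
  | cons i l ih => exact ih.fderiv_apply ℝ _

lemma foldr_pderiv_convolution (l : List (Fin n)) {f g : Rn n → ℝ}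
    (hf : LocallyIntegrable f volume) (hgc : HasCompactSupport g)
    (hg : ContDiff ℝ l.length g) (x : Rn n) :
    l.foldr pderiv (fun x => ∫ z, f z * g (x - z)) x =
      ∫ z, f z * (l.foldr pderiv g) (x - z) := by
  induction l generalizing x with
  | nil => rfl
  | cons i l ih =>
    have h1 : ContDiff ℝ 1 (l.foldr pderiv g) :=
      contDiff_foldr_pderiv l (k := 1) (by simpa using hg)
    have h2 := hasCompactSupport_foldr_pderiv l hgc
    have h3 := funext (ih (hg.of_le (by simp)))
    rw [List.foldr_cons, h3]
    have h4 := h2.hasFDerivAt_convolution_right (ContinuousLinearMap.mul ℝ ℝ) hf h1 x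
    have h5 := convolution_precompR_apply (ContinuousLinearMap.mul ℝ ℝ) hf (h2.fderiv ℝ)
      (h1.continuous_fderiv one_ne_zero) x (EuclideanSpace.single i 1)
    rw [← h4.fderiv] at h5
    exact h5

lemma foldr_pderiv_eq_iteratedFDeriv (l : List (Fin n)) {f : Rn n → ℝ}
    (hf : ContDiff ℝ (⊤ : ℕ∞) f) (x : Rn n) :
    l.foldr pderiv f x =
      iteratedFDeriv ℝ l.length f x (fun j => EuclideanSpace.single (l.get j) 1) := by
  induction l generalizing x with
  | nil => simp
  | cons i l ih =>
    rw [List.foldr_cons, funext ih]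
    have hd : DifferentiableAt ℝ (iteratedFDeriv ℝ l.length f) x :=
      (hf.differentiable_iteratedFDeriv (by exact_mod_cast ENat.natCast_lt_top l.length)) x
    rw [pderiv, fderiv_continuousMultilinear_apply_const_apply hd]
    rfl

lemma abs_foldr_pderiv_le (l : List (Fin n)) {f : Rn n → ℝ}
    (hf : ContDiff ℝ (⊤ : ℕ∞) f) (x : Rn n) :
    |l.foldr pderiv f x| ≤ ‖iteratedFDeriv ℝ l.length f x‖ := by
  rw [foldr_pderiv_eq_iteratedFDeriv l hf, ← Real.norm_eq_abs]
  refine (ContinuousMultilinearMap.le_opNorm _ _).trans ?_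
  simp

open scoped FourierTransform RealInnerProductSpace

/-- Smoothness and derivative bounds for the inverse Fourier transform of a function with
finite absolute moments. -/
lemma fourierInv_smooth_bound {h : Rn n → ℂ} (hm : AEStronglyMeasurable h volume)
    (hi : ∀ m : ℕ, Integrable (fun v => ‖v‖ ^ m * ‖h v‖)) :
    ContDiff ℝ (⊤ : ℕ∞) (𝓕⁻ h) ∧ ∀ (m : ℕ) (x : Rn n),
      ‖iteratedFDeriv ℝ m (𝓕⁻ h) x‖ ≤ (2 * Real.pi) ^ m * ∫ v, ‖v‖ ^ m * ‖h v‖ := by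
  set L : Rn n →L[ℝ] Rn n →L[ℝ] ℝ := -(innerSL ℝ) with hL
  have hLn : ‖L‖ ≤ 1 := by
    refine L.opNorm_le_bound zero_le_one fun v => ?_
    refine (L v).opNorm_le_bound (by positivity) fun w => ?_
    rw [one_mul, Real.norm_eq_abs]
    exact (abs_neg (inner ℝ v w)).trans_le (abs_real_inner_le_norm v w)
  have hF : 𝓕⁻ h = VectorFourier.fourierIntegral Real.fourierChar volume L.toLinearMap₁₂ h := by
    ext x
    rw [Real.fourierInv_eq, VectorFourier.fourierIntegral]
    simp [hL]
    rfl
  rw [hF]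
  refine ⟨VectorFourier.contDiff_fourierIntegral L (N := ⊤) (fun m _ => hi m), fun m x => ?_⟩
  rw [VectorFourier.iteratedFDeriv_fourierIntegral L (N := ⊤) (fun m _ => hi m) hm
    (by exact_mod_cast le_top)]
  refine (VectorFourier.norm_fourierIntegral_le_integral_norm _ _ _ _ _).trans ?_
  rw [← integral_const_mul]
  refine integral_mono_of_nonneg (ae_of_all _ fun _ => norm_nonneg _) ((hi m).const_mul _)
    (ae_of_all _ fun v => ?_)
  change _ ≤ (2 * Real.pi) ^ m * (‖v‖ ^ m * ‖h v‖)
  refine (VectorFourier.norm_fourierPowSMulRight_le L h v m).trans ?_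
  rw [mul_assoc]
  have : 2 * Real.pi * ‖L‖ ≤ 2 * Real.pi := by
    have := Real.pi_pos
    nlinarith
  gcongr

lemma exists_schwartz_one_on_ball (R : ℝ) (hR : 0 < R) :
    ∃ B : SchwartzMap (Rn n) ℂ, ∀ x ∈ Metric.ball (0 : Rn n) R, B x = 1 := by
  let b : ContDiffBump (0 : Rn n) := ⟨R, R + 1, hR, by linarith⟩
  have h1 : HasCompactSupport (fun x => ((b x : ℝ) : ℂ)) :=
    b.hasCompactSupport.comp_left Complex.ofReal_zero
  refine ⟨h1.toSchwartzMap (Complex.ofRealCLM.contDiff.comp b.contDiff), fun x hx => ?_⟩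
  have : b x = 1 := b.one_of_mem_closedBall (Metric.ball_subset_closedBall hx)
  change ((b x : ℝ) : ℂ) = 1
  rw [this, Complex.ofReal_one]

/-- A density of `K̂` may be chosen measurable. -/
lemma exists_aestronglyMeasurable_density (K : SchwartzMap (Rn n) ℂ →L[ℂ] ℂ) {k : Rn n → ℂ}
    {C α : ℝ} (hC : 0 ≤ C)
    (hk : ∀ φ : SchwartzMap (Rn n) ℂ,
        K (SchwartzMap.fourierTransformCLM ℂ φ) = ∫ ξ, k ξ * φ ξ)
    (hb : ∀ ξ : Rn n, ξ ≠ 0 → ‖k ξ‖ ≤ C * ‖ξ‖ ^ (-α)) :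
    ∃ k' : Rn n → ℂ, AEStronglyMeasurable k' volume ∧
      (∀ φ : SchwartzMap (Rn n) ℂ,
        K (SchwartzMap.fourierTransformCLM ℂ φ) = ∫ ξ, k' ξ * φ ξ) ∧
      ∀ ξ : Rn n, ξ ≠ 0 → ‖k' ξ‖ ≤ C * ‖ξ‖ ^ (-α) := by
  by_cases hm : AEStronglyMeasurable k volume
  · exact ⟨k, hm, hk, hb⟩
  refine ⟨0, aestronglyMeasurable_const, fun g => ?_, fun ξ _ => ?_⟩
  swap
  · simpa using mul_nonneg hC (Real.rpow_nonneg (norm_nonneg _) _)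
  obtain ⟨R, hR⟩ : ∃ R : ℕ, ¬ AEStronglyMeasurable k
      (volume.restrict (Metric.ball (0 : Rn n) (R + 1))) := by
    by_contra! hc
    apply hm
    have h := AEStronglyMeasurable.iUnion hc
    have hu : (⋃ R : ℕ, Metric.ball (0 : Rn n) (R + 1)) = Set.univ :=
      Set.iUnion_eq_univ_iff.2 fun x => by
        obtain ⟨m, hm⟩ := exists_nat_gt ‖x‖
        exact ⟨m, by rw [mem_ball_zero_iff]; linarith⟩
    rwa [hu, Measure.restrict_univ] at h
  obtain ⟨B, hB⟩ := exists_schwartz_one_on_ball (n := n) (R + 1) (by positivity)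
  have key : ∀ u : SchwartzMap (Rn n) ℂ, (∀ x ∈ Metric.ball (0 : Rn n) (R + 1), u x ≠ 0) →
      K (SchwartzMap.fourierTransformCLM ℂ u) = 0 := by
    intro u hu
    rw [hk]
    refine integral_undef fun hint => hR ?_
    have h1 : AEStronglyMeasurable (fun x => k x * u x * (u x)⁻¹) volume :=
      hint.aestronglyMeasurable.mul u.continuous.measurable.inv.aestronglyMeasurable
    refine h1.restrict.congr ?_
    filter_upwards [ae_restrict_mem Metric.isOpen_ball.measurableSet] with x hx
    rw [mul_assoc, mul_inv_cancel₀ (hu x hx), mul_one]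
  obtain ⟨M, hM⟩ : ∃ M : ℝ, ∀ x, ‖g x‖ ≤ M := by
    obtain ⟨M, hM⟩ := g.decay 0 0
    exact ⟨M, fun x => by simpa using hM.2 x⟩
  have hM0 : 0 ≤ M := (norm_nonneg _).trans (hM 0)
  have h1 := key B fun x hx => by rw [hB x hx]; exact one_ne_zero
  have h2 := key (g + ((M + 1 : ℝ) : ℂ) • B) fun x hx h0 => by
    simp only [add_apply, smul_apply, hB x hx, smul_eq_mul, mul_one] at h0
    have h3 := hM x
    rw [eq_neg_of_add_eq_zero_left h0, norm_neg, Complex.norm_real, Real.norm_eq_abs,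
      abs_of_nonneg (by linarith)] at h3
    linarith
  rw [map_add, map_add, map_smul, map_smul, h1, smul_zero, add_zero] at h2
  simp only [Pi.zero_apply, zero_mul, integral_zero, h2]

lemma integrable_pow_mul_rpow_mul_schwartz {α : ℝ} (hα0 : 0 ≤ α) (hαn : α < n)
    (g : SchwartzMap (Rn n) ℂ) (m : ℕ) :
    Integrable (fun v : Rn n => ‖v‖ ^ m * (‖v‖ ^ (-α) * ‖g v‖)) := by
  have hn : 1 ≤ n := by
    have : (0 : ℝ) < n := hα0.trans_lt hαn
    exact_mod_cast this
  have hmeas : Measurable (fun v : Rn n => ‖v‖ ^ (-α)) := by fun_prop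
  have hloc : LocallyIntegrable (fun v : Rn n => ‖v‖ ^ (-α)) volume := by
    refine locallyIntegrable_of_norm_le_rpow (C := 1) (α := α) (by simpa using hn)
      (by simpa using hαn) (ae_of_all _ fun x => ?_) hmeas.aestronglyMeasurable
    rw [Real.norm_eq_abs, abs_of_nonneg (by positivity), one_mul]
  have hcont : Continuous (fun v : Rn n => ‖v‖ ^ m * ‖g v‖) := by
    have := g.continuous
    fun_prop
  rw [← integrableOn_univ, ← Set.union_compl_self (Metric.closedBall (0 : Rn n) 1)]
  refine IntegrableOn.union ?_ ?_
  · have := (hloc.integrableOn_isCompact (isCompact_closedBall (0 : Rn n) 1)).mul_continuousOn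
      hcont.continuousOn (isCompact_closedBall (0 : Rn n) 1)
    refine this.congr (ae_of_all _ fun v => ?_)
    ring
  · refine ((g.integrable_pow_mul volume m).integrableOn).mono' ?_ ?_
    · have := g.continuous
      have : Measurable (fun v : Rn n => ‖v‖ ^ m * (‖v‖ ^ (-α) * ‖g v‖)) := by fun_prop
      exact this.aestronglyMeasurable
    · filter_upwards [ae_restrict_mem Metric.isClosed_closedBall.measurableSet.compl] with v hv
      have hv : 1 ≤ ‖v‖ := by
        simp only [Set.mem_compl_iff, mem_closedBall_zero_iff, not_le] at hv
        exact hv.le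
      rw [Real.norm_eq_abs, abs_of_nonneg (by positivity)]
      have : ‖v‖ ^ (-α) ≤ 1 := Real.rpow_le_one_of_one_le_of_nonpos hv (by linarith)
      gcongr
      exact mul_le_of_le_one_left (norm_nonneg _) this

lemma fourierInv_dilate_translate (Φ : SchwartzMap (Rn n) ℂ) {t : ℝ} (ht : 0 < t) (x : Rn n)
    (ψ : SchwartzMap (Rn n) ℂ)
    (hψ : ∀ y, ψ y = (((t ^ n)⁻¹ : ℝ) : ℂ) * Φ (t⁻¹ • (x - y))) (ξ : Rn n) :
    𝓕⁻ (ψ : Rn n → ℂ) ξ = Real.fourierChar ⟪ξ, x⟫ • 𝓕 (Φ : Rn n → ℂ) (t • ξ) := by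
  rw [Real.fourierInv_eq, Real.fourier_eq]
  set G : Rn n → ℂ := fun z => Real.fourierChar ⟪x - t • z, ξ⟫ • Φ z with hG
  have h1 : ∀ y, Real.fourierChar ⟪y, ξ⟫ • ψ y =
      (((t ^ n)⁻¹ : ℝ) : ℂ) * G (t⁻¹ • (x - y)) := by
    intro y
    have e : x - (x - y) = y := sub_sub_cancel x y
    simp only [hG, hψ, smul_smul, mul_inv_cancel₀ ht.ne', one_smul, e,
      Circle.smul_def, smul_eq_mul]
    ring
  simp_rw [h1]
  rw [integral_const_mul, integral_sub_left_eq_self (fun y => G (t⁻¹ • y)) volume x,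
    Measure.integral_comp_inv_smul_of_nonneg volume G ht.le, finrank_euclideanSpace_fin,
    Complex.real_smul, ← mul_assoc, ← Complex.ofReal_mul,
    inv_mul_cancel₀ (pow_pos ht n).ne', Complex.ofReal_one, one_mul, Circle.smul_def,
    smul_eq_mul, ← integral_const_mul]
  refine integral_congr_ae (ae_of_all _ fun z => ?_)
  simp only [hG, Circle.smul_def, smul_eq_mul, ← mul_assoc, ← Circle.coe_mul,
    ← AddChar.map_add_eq_mul]
  congr 3
  rw [inner_sub_left, real_inner_smul_left, real_inner_smul_right, real_inner_comm]
  ring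

/-- Derivatives of a mollification fall on the kernel at points further from the origin than the
radius of the mollifier. -/
lemma foldr_pderiv_mollification {f K₀ F : Rn n → ℝ} {t : ℝ} (ht : 0 < t) {M : ℕ}
    (hf : LocallyIntegrable f volume) (hft : ∀ z, t ≤ ‖z‖ → f z = 0)
    (hK : ContDiffOn ℝ M K₀ {0}ᶜ)
    (hF : ∀ x, t < ‖x‖ → F x = ∫ z, f z * K₀ (x - z))
    (l : List (Fin n)) (hl : l.length ≤ M) {x : Rn n} (hx : t < ‖x‖) :
    l.foldr pderiv F x = ∫ z, f z * (l.foldr pderiv K₀) (x - z) := by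
  let χ : ContDiffBump x := ⟨(2 * t + ‖x‖) / 3, (t + 2 * ‖x‖) / 3, by positivity, by linarith⟩
  set g : Rn n → ℝ := fun y => χ y * K₀ y with hg
  have hgc : HasCompactSupport g := χ.hasCompactSupport.mul_right
  have hgs : ContDiff ℝ M g := by
    rw [contDiff_iff_contDiffAt]
    intro y
    rcases eq_or_ne y 0 with rfl | hy
    · have h0 : (0 : Rn n) ∉ tsupport χ := by
        rw [χ.tsupport_eq, Metric.mem_closedBall, dist_zero_left, not_le]
        change (t + 2 * ‖x‖) / 3 < ‖x‖
        linarith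
      have h1 : g =ᶠ[𝓝 0] fun _ => 0 := by
        filter_upwards [notMem_tsupport_iff_eventuallyEq.1 h0] with z hz
        simp only [hg, hz, Pi.zero_apply, zero_mul]
      exact contDiffAt_const.congr_of_eventuallyEq h1
    · exact χ.contDiffAt.mul (hK.contDiffAt (isOpen_compl_singleton.mem_nhds hy))
  have hFg : F =ᶠ[𝓝 x] fun x' => ∫ z, f z * g (x' - z) := by
    filter_upwards [Metric.ball_mem_nhds x (show 0 < (‖x‖ - t) / 3 by linarith)] with y hy
    rw [mem_ball_iff_norm] at hy
    have hy' : t < ‖y‖ := by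
      have := norm_sub_norm_le x y
      rw [norm_sub_rev] at this
      linarith
    rw [hF y hy']
    refine integral_congr_ae (ae_of_all _ fun z => ?_)
    rcases le_or_gt t ‖z‖ with hz | hz
    · simp only [hft z hz, zero_mul]
    · have : χ (y - z) = 1 := by
        refine χ.one_of_mem_closedBall ?_
        rw [mem_closedBall_iff_norm]
        change _ ≤ (2 * t + ‖x‖) / 3
        have := norm_sub_le (y - x) z
        rw [sub_right_comm] at this
        linarith
      simp only [hg, this, one_mul]
  rw [(foldr_pderiv_congr l hFg).eq_of_nhds,
    foldr_pderiv_convolution l hf hgc (hgs.of_le (by exact_mod_cast hl))]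
  refine integral_congr_ae (ae_of_all _ fun z => ?_)
  rcases le_or_gt t ‖z‖ with hz | hz
  · simp only [hft z hz, zero_mul]
  · have hmem : x - z ∈ Metric.ball x χ.rIn := by
      rw [mem_ball_iff_norm, sub_sub_cancel_left, norm_neg]
      change _ < (2 * t + ‖x‖) / 3
      linarith
    have : g =ᶠ[𝓝 (x - z)] K₀ := by
      filter_upwards [χ.eventuallyEq_one_of_mem_ball hmem] with w hw
      simp only [hg, hw, Pi.one_apply, one_mul]
    simp only [(foldr_pderiv_congr l this).eq_of_nhds]

/-- Scale-dependent bounds for a function whose Fourier transform is `k ξ * g (t • ξ)`. -/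
lemma foldr_pderiv_le_of_eq_fourierInv {α C t : ℝ} (hα0 : 0 ≤ α) (hαn : α < n)
    (ht : 0 < t) {k : Rn n → ℂ} (hm : AEStronglyMeasurable k volume)
    (hb : ∀ ξ : Rn n, ξ ≠ 0 → ‖k ξ‖ ≤ C * ‖ξ‖ ^ (-α)) (g : SchwartzMap (Rn n) ℂ)
    {F : Rn n → ℝ} (hF : ∀ x, (F x : ℂ) = 𝓕⁻ (fun ξ => k ξ * g (t • ξ)) x) :
    ContDiff ℝ (⊤ : ℕ∞) F ∧ ∀ (l : List (Fin n)) (x : Rn n),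
      |l.foldr pderiv F x| ≤ (2 * Real.pi) ^ l.length * C *
        (∫ v : Rn n, ‖v‖ ^ l.length * (‖v‖ ^ (-α) * ‖g v‖)) *
          t ^ (-((n : ℝ) - α + l.length)) := by
  have hn : 0 < n := by
    have : (0 : ℝ) < n := hα0.trans_lt hαn
    exact_mod_cast this
  have : NeZero n := ⟨hn.ne'⟩
  set h : Rn n → ℂ := fun ξ => k ξ * g (t • ξ) with hh
  have hgt : Continuous fun ξ : Rn n => g (t • ξ) := g.continuous.comp (continuous_const_smul t)
  have hhm : AEStronglyMeasurable h volume := hm.mul hgt.aestronglyMeasurable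
  set G : ℕ → Rn n → ℝ := fun m v => ‖v‖ ^ m * (‖v‖ ^ (-α) * ‖g v‖) with hG
  have hGi : ∀ m, Integrable (G m) := integrable_pow_mul_rpow_mul_schwartz hα0 hαn g
  have hGt : ∀ m, Integrable fun v => C * (t ^ α * (t ^ m)⁻¹) * G m (t • v) := fun m =>
    ((hGi m).comp_smul ht.ne').const_mul _
  have hle : ∀ m : ℕ, ∀ᵐ v : Rn n, ‖v‖ ^ m * ‖h v‖ ≤ C * (t ^ α * (t ^ m)⁻¹) * G m (t • v) := by
    intro m
    filter_upwards [compl_mem_ae_iff.2 (measure_singleton (0 : Rn n))] with v hv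
    have hv : v ≠ 0 := hv
    have e : C * (t ^ α * (t ^ m)⁻¹) * G m (t • v) =
        ‖v‖ ^ m * (C * ‖v‖ ^ (-α) * ‖g (t • v)‖) := by
      simp only [hG, norm_smul, Real.norm_eq_abs, abs_of_pos ht, mul_pow]
      rw [Real.mul_rpow ht.le (norm_nonneg v), Real.rpow_neg ht.le]
      have := (Real.rpow_pos_of_pos ht α).ne'
      have := (pow_pos ht m).ne'
      field_simp
    rw [e, hh, norm_mul]
    gcongr
    exact hb v hv
  have hi : ∀ m : ℕ, Integrable fun v => ‖v‖ ^ m * ‖h v‖ := by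
    intro m
    refine (hGt m).mono' ?_ ?_
    · exact (continuous_norm.pow m).aestronglyMeasurable.mul hhm.norm
    · filter_upwards [hle m] with v hv
      rwa [Real.norm_eq_abs, abs_of_nonneg (by positivity)]
  obtain ⟨hs, hbd⟩ := fourierInv_smooth_bound hhm hi
  have hFre : F = Complex.reCLM ∘ 𝓕⁻ h := by
    ext x
    rw [Function.comp_apply, ← hF]
    simp
  have hFs : ContDiff ℝ (⊤ : ℕ∞) F := hFre ▸ Complex.reCLM.contDiff.comp hs
  refine ⟨hFs, fun l x => (abs_foldr_pderiv_le l hFs x).trans ?_⟩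
  have h1 : ‖iteratedFDeriv ℝ l.length F x‖ ≤ ‖iteratedFDeriv ℝ l.length (𝓕⁻ h) x‖ := by
    rw [hFre]
    refine (Complex.reCLM.norm_iteratedFDeriv_comp_left hs.contDiffAt
      (by exact_mod_cast le_top)).trans ?_
    rw [Complex.reCLM_norm, one_mul]
  refine (h1.trans (hbd _ x)).trans ?_
  have h2 := integral_mono_ae (hi l.length) (hGt l.length) (hle l.length)
  rw [integral_const_mul, Measure.integral_comp_smul_of_nonneg volume (G l.length) t (hR := ht.le),
    finrank_euclideanSpace_fin, smul_eq_mul] at h2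
  refine (mul_le_mul_of_nonneg_left h2 (by positivity)).trans_eq ?_
  have e : t ^ (-((n : ℝ) - α + l.length)) = (t ^ n)⁻¹ * (t ^ α * (t ^ l.length)⁻¹) := by
    rw [show -((n : ℝ) - α + l.length) = -(n : ℝ) + (α + -(l.length : ℝ)) by ring,
      Real.rpow_add ht, Real.rpow_add ht, Real.rpow_neg ht.le, Real.rpow_neg ht.le,
      Real.rpow_natCast, Real.rpow_natCast]
  rw [e]
  ring

lemma half_rpow_neg_le {r s : ℝ} {M : ℕ} (hr : 0 ≤ r) (hs : s ≤ M) :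
    (r / 2) ^ (-s) ≤ 2 ^ M * r ^ (-s) := by
  rw [Real.div_rpow hr zero_le_two, div_eq_mul_inv, mul_comm, Real.rpow_neg zero_le_two, inv_inv,
    ← Real.rpow_natCast 2 M]
  gcongr
  norm_num

lemma dilate_eq_zero {φ : Rn n → ℝ} (hφ : ∀ z, 1 ≤ ‖z‖ → φ z = 0) {t : ℝ} (ht : 0 < t)
    {z : Rn n} (hz : t ≤ ‖z‖) : φ (t⁻¹ • z) = 0 := by
  refine hφ _ ?_
  rw [norm_smul, norm_inv, Real.norm_eq_abs, abs_of_pos ht, inv_mul_eq_div, one_le_div ht]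
  exact hz

lemma exists_schwartz_dilate_translate {φ : Rn n → ℝ} (hφs : ContDiff ℝ (⊤ : ℕ∞) φ)
    (hφ : ∀ z, 1 ≤ ‖z‖ → φ z = 0) {t : ℝ} (ht : 0 < t) (x : Rn n) :
    ∃ ψ : SchwartzMap (Rn n) ℂ,
      ∀ y, ψ y = (((t ^ n)⁻¹ * φ (t⁻¹ • (x - y)) : ℝ) : ℂ) := by
  have hs : ContDiff ℝ (⊤ : ℕ∞)
      fun y : Rn n => (((t ^ n)⁻¹ * φ (t⁻¹ • (x - y)) : ℝ) : ℂ) :=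
    Complex.ofRealCLM.contDiff.comp
      (contDiff_const.mul (hφs.comp ((contDiff_const.sub contDiff_id).const_smul t⁻¹)))
  have hc : HasCompactSupport
      fun y : Rn n => (((t ^ n)⁻¹ * φ (t⁻¹ • (x - y)) : ℝ) : ℂ) := by
    refine HasCompactSupport.intro (isCompact_closedBall x t) fun y hy => ?_
    rw [mem_closedBall_iff_norm', not_le] at hy
    rw [dilate_eq_zero hφ ht hy.le, mul_zero, Complex.ofReal_zero]
  exact ⟨hc.toSchwartzMap hs, fun _ => rfl⟩

/-- (Mollified kernel estimates.)  Let `K` be a tempered distribution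
with `|K̂(ξ)| ≤ C|ξ|^{-α}` that agrees away from the origin with a `C^{N+1}` function
`K₀` satisfying `|∂^β K₀(x)| ≤ B₀ |x|^{-(n-α+|β|)}` for `|β| ≤ N+1`.  If `φ ∈ C_c^∞` is
supported in `B(0,1)` with `∫ φ = 1` and `K^t = φ_t * K`, then each `K^t` is smooth and
`|∂^β K^t(x)| ≤ B₁ |x|^{-(n-α+|β|)}` for `|β| ≤ N+1`, with `B₁` independent of `t`. -/
theorem stmt16_mollified_kernel_estimates (n : ℕ) (N : ℕ) (α : ℝ)
    (hα0 : 0 ≤ α) (hαn : α < n)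
    (K : SchwartzMap (Rn n) ℂ →L[ℂ] ℂ) (K₀ : Rn n → ℝ)
    (hKhat : ∃ (k : Rn n → ℂ) (C : ℝ), 0 < C ∧
      (∀ φ : SchwartzMap (Rn n) ℂ,
        K (SchwartzMap.fourierTransformCLM ℂ φ) = ∫ ξ, k ξ * φ ξ) ∧
      ∀ ξ : Rn n, ξ ≠ 0 → ‖k ξ‖ ≤ C * ‖ξ‖ ^ (-α))
    (hagree : ∀ φ : SchwartzMap (Rn n) ℂ, (∃ ε : ℝ, 0 < ε ∧ ∀ y : Rn n, ‖y‖ < ε → φ y = 0) →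
      K φ = ∫ y, (K₀ y : ℂ) * φ y)
    (hK₀smooth : ContDiffOn ℝ (N + 1 : ℕ) K₀ {0}ᶜ)
    (hK₀bound : ∃ B₀ : ℝ, 0 < B₀ ∧ ∀ β : Fin n → ℕ, (∑ i, β i) ≤ N + 1 →
      ∀ x : Rn n, x ≠ 0 →
        |multiDeriv β K₀ x| ≤ B₀ * ‖x‖ ^ (-((n : ℝ) - α + (∑ i, β i))))
    (φ : Rn n → ℝ) (hφs : ContDiff ℝ (⊤ : ℕ∞) φ)
    (hφc : tsupport φ ⊆ Metric.ball 0 1) (hφi : ∫ x, φ x = 1)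
    (Kt : ℝ → Rn n → ℝ)
    (hKt : ∀ t : ℝ, 0 < t → ∀ x : Rn n, ∀ ψ : SchwartzMap (Rn n) ℂ,
      (∀ y, ψ y = (((t ^ n)⁻¹ * φ (t⁻¹ • (x - y)) : ℝ) : ℂ)) → (Kt t x : ℂ) = K ψ) :
    ∃ B₁ : ℝ, 0 < B₁ ∧ ∀ t : ℝ, 0 < t →
      ContDiff ℝ (⊤ : ℕ∞) (Kt t) ∧
      ∀ β : Fin n → ℕ, (∑ i, β i) ≤ N + 1 → ∀ x : Rn n, x ≠ 0 →
        |multiDeriv β (Kt t) x| ≤ B₁ * ‖x‖ ^ (-((n : ℝ) - α + (∑ i, β i))) := by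
  obtain ⟨k₁, C, hC, hk₁, hb₁⟩ := hKhat
  obtain ⟨k, hkm, hk, hb⟩ := exists_aestronglyMeasurable_density K hC.le hk₁ hb₁
  obtain ⟨B₀, hB₀, hK₀⟩ := hK₀bound
  have hφ0 : ∀ z : Rn n, 1 ≤ ‖z‖ → φ z = 0 := fun z hz =>
    image_eq_zero_of_notMem_tsupport fun h => by
      have := mem_ball_zero_iff.1 (hφc h)
      linarith
  have hφcs : HasCompactSupport φ :=
    HasCompactSupport.intro (isCompact_closedBall 0 1) fun z hz => by
      rw [mem_closedBall_zero_iff, not_le] at hz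
      exact hφ0 z hz.le
  obtain ⟨Φ, hΦ⟩ := exists_schwartz_dilate_translate (n := n) (φ := fun z => φ (-z))
    (hφs.comp contDiff_neg) (fun z hz => hφ0 _ (by rwa [norm_neg])) one_pos 0
  have hΦ' : ∀ z, Φ z = (φ z : ℂ) := fun z => by simp [hΦ]
  have hfourier : ∀ t : ℝ, 0 < t → ∀ x : Rn n,
      (Kt t x : ℂ) = 𝓕⁻ (fun ξ => k ξ * (𝓕 Φ) (t • ξ)) x := by
    intro t ht x
    obtain ⟨ψ, hψ⟩ := exists_schwartz_dilate_translate hφs hφ0 ht x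
    have h1 : ψ = SchwartzMap.fourierTransformCLM ℂ (𝓕⁻ ψ) := by
      rw [SchwartzMap.fourierTransformCLM_apply, FourierTransform.fourier_fourierInv_eq]
    rw [hKt t ht x ψ hψ, h1, hk, Real.fourierInv_eq]
    refine integral_congr_ae (ae_of_all _ fun ξ => ?_)
    have h2 := fourierInv_dilate_translate Φ ht x ψ
      (fun y => by rw [hψ, hΦ', Complex.ofReal_mul]) ξ
    simp only [SchwartzMap.fourierInv_coe, h2, SchwartzMap.fourier_coe, Circle.smul_def,
      smul_eq_mul]
    ring
  set J : ℕ → ℝ := fun m =>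
    (2 * Real.pi) ^ m * C * ∫ v : Rn n, ‖v‖ ^ m * (‖v‖ ^ (-α) * ‖(𝓕 Φ) v‖) with hJ
  have hJ0 : ∀ m, 0 ≤ J m := fun m => by
    have : 0 ≤ ∫ v : Rn n, ‖v‖ ^ m * (‖v‖ ^ (-α) * ‖(𝓕 Φ) v‖) :=
      integral_nonneg fun v => by positivity
    have := Real.pi_pos
    positivity
  set I : ℝ := ∫ z, |φ z| with hI
  have hI0 : 0 ≤ I := integral_nonneg fun _ => abs_nonneg _
  have hS0 : 0 ≤ ∑ m ∈ Finset.range (N + 2), J m := Finset.sum_nonneg fun m _ => hJ0 m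
  refine ⟨2 ^ (n + N + 1) * (I * B₀ + ∑ m ∈ Finset.range (N + 2), J m) + 1, by positivity,
    fun t ht => ?_⟩
  obtain ⟨hsmooth, hbound⟩ := foldr_pderiv_le_of_eq_fourierInv hα0 hαn ht hkm hb (𝓕 Φ)
    (hfourier t ht)
  refine ⟨hsmooth, fun β hβ x hx => ?_⟩
  obtain ⟨l, hl, hlβ⟩ := exists_list_multiDeriv β
  rw [hlβ]
  have hx0 : 0 < ‖x‖ := norm_pos_iff.2 hx
  rw [← hl]
  have hlN : l.length ≤ N + 1 := hl ▸ hβ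
  set s : ℝ := (n : ℝ) - α + l.length with hs
  have hs0 : 0 ≤ s := by
    have : (0 : ℝ) ≤ l.length := Nat.cast_nonneg _
    linarith
  have hsM : s ≤ (n + N + 1 : ℕ) := by
    have : (l.length : ℝ) ≤ N + 1 := by exact_mod_cast hlN
    push_cast
    linarith
  suffices hA : ∃ A : ℝ, 0 ≤ A ∧ A ≤ I * B₀ + ∑ m ∈ Finset.range (N + 2), J m ∧
      |l.foldr pderiv (Kt t) x| ≤ A * (‖x‖ / 2) ^ (-s) by
    obtain ⟨A, hA0, hA1, hA2⟩ := hA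
    have hp : 0 ≤ ‖x‖ ^ (-s) := by positivity
    calc |l.foldr pderiv (Kt t) x| ≤ A * (‖x‖ / 2) ^ (-s) := hA2
      _ ≤ (I * B₀ + ∑ m ∈ Finset.range (N + 2), J m) * (2 ^ (n + N + 1) * ‖x‖ ^ (-s)) :=
        mul_le_mul hA1 (half_rpow_neg_le (norm_nonneg x) hsM) (by positivity) (hA0.trans hA1)
      _ ≤ _ := by linarith
  rcases le_or_gt ‖x‖ (2 * t) with hxt | hxt
  · refine ⟨J l.length, hJ0 _, ?_, ?_⟩
    · have := Finset.single_le_sum (f := J) (fun m _ => hJ0 m)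
        (Finset.mem_range.2 (show l.length < N + 2 by omega))
      have : 0 ≤ I * B₀ := by positivity
      linarith
    · refine (hbound l x).trans ?_
      refine mul_le_mul_of_nonneg_left ?_ (hJ0 _)
      exact Real.rpow_le_rpow_of_nonpos (by positivity) (by linarith) (by linarith)
  · refine ⟨I * B₀, by positivity, by linarith, ?_⟩
    set f : Rn n → ℝ := fun z => (t ^ n)⁻¹ * φ (t⁻¹ • z) with hf
    have hfc : Continuous f :=
      continuous_const.mul (hφs.continuous.comp (continuous_const_smul _))
    have hft : ∀ z, t ≤ ‖z‖ → f z = 0 := fun z hz => by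
      rw [hf]; simp only [dilate_eq_zero hφ0 ht hz, mul_zero]
    have hconv : ∀ y, t < ‖y‖ → Kt t y = ∫ z, f z * K₀ (y - z) := by
      intro y hy
      obtain ⟨ψ, hψ⟩ := exists_schwartz_dilate_translate hφs hφ0 ht y
      have h1 := hKt t ht y ψ hψ
      rw [hagree ψ ⟨‖y‖ - t, by linarith, fun w hw => ?_⟩] at h1
      · rw [← integral_sub_left_eq_self (fun z => f z * K₀ (y - z)) volume y]
        rw [← Complex.ofReal_inj, h1, ← integral_complex_ofReal]
        refine integral_congr_ae (ae_of_all _ fun w => ?_)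
        have e : y - (y - w) = w := sub_sub_cancel y w
        simp only [hψ, hf, e]
        push_cast
        ring
      · have := norm_sub_norm_le y w
        rw [hψ, dilate_eq_zero hφ0 ht (by linarith), mul_zero, Complex.ofReal_zero]
    rw [foldr_pderiv_mollification ht hfc.locallyIntegrable hft hK₀smooth hconv l hlN
      (by linarith), ← Real.norm_eq_abs]
    have hfi : Integrable fun z => |f z| := by
      have h1 : Integrable φ := hφs.continuous.integrable_of_hasCompactSupport hφcs
      exact ((h1.comp_smul (inv_ne_zero ht.ne')).const_mul _).abs
    have hfI : ∫ z, |f z| = I := by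
      have h1 : ∀ z, |f z| = (t ^ n)⁻¹ * |φ (t⁻¹ • z)| := fun z => by
        rw [hf, abs_mul, abs_of_pos (by positivity)]
      simp_rw [h1]
      rw [integral_const_mul,
        Measure.integral_comp_inv_smul_of_nonneg volume (fun z => |φ z|) ht.le,
        finrank_euclideanSpace_fin, smul_eq_mul, inv_mul_cancel_left₀ (pow_pos ht n).ne']
    have h2 := norm_integral_le_of_norm_le (hfi.mul_const (B₀ * (‖x‖ / 2) ^ (-s)))
      (f := fun z => f z * (l.foldr pderiv K₀) (x - z)) (ae_of_all _ fun z => ?_)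
    · rwa [integral_mul_const, hfI, ← mul_assoc] at h2
    · rw [norm_mul, Real.norm_eq_abs, Real.norm_eq_abs]
      rcases le_or_gt t ‖z‖ with hz | hz
      · simp only [hft z hz, abs_zero, zero_mul, le_refl]
      · have hxz : ‖x‖ / 2 ≤ ‖x - z‖ := by
          have := norm_sub_norm_le x z
          linarith
        have h3 := hK₀ β hβ (x - z) (norm_pos_iff.1 (by linarith))
        rw [hlβ, ← hl] at h3
        gcongr
        refine h3.trans (mul_le_mul_of_nonneg_left ?_ hB₀.le)
        exact Real.rpow_le_rpow_of_nonpos (by positivity) hxz (by linarith)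
end
end
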